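/- Let k ≥ 0, d ≥ 1 be integers, s = (k+1)/d, σ > 0, N > k+1, n = N^d, and 0 < C_n ≤ √n. Let {v_i : i ∈ {1,…,N}^d} be an orthonormal basis of ℝ^n of eigenvectors of (D_{n,d}^{(k+1)})ᵀ D_{n,d}^{(k+1)} with v_i having eigenvalue ξ_i = ρ_{i_1} + ⋯ + ρ_{i_d}, where ρ_1 ≤ ⋯ ≤ ρ_N are the increasingly ordered eigenvalues of (D_N^{(k+1)})ᵀ D_N^{(k+1)}; for Q ⊆ {1,…,N}^d let S_Q = V_Q V_Qᵀ denote orthogonal projection onto span{v_i : i ∈ Q}. There exists a constant C > 0 depending only on k, d, σ such that: (i) if s < 1/2, the polynomial projection estimator θ̂ = S_Q y with Q = {1,…,k+1}^d (projection onto the null space of D_{n,d}^{(k+1)}) satisfies sup_{θ₀ ∈ 𝒯_{n,d}^k(C_n)} (1/n) E‖θ̂ − θ₀‖₂² ≤ C ( 1/n + C_n²/n ); and (ii) if s > 1/2, there exists an integer τ ∈ {k+2, …, N} with τ^d ≤ C·max{1, (C_n n^{s−1/2})^{1/s}} such that the projection estimator θ̂ = S_Q y with Q = {1,…,τ}^d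 satisfies sup_{θ₀ ∈ 𝒯_{n,d}^k(C_n)} (1/n) E‖θ̂ − θ₀‖₂² ≤ C ( 1/n + (C_n²/n)^{1/(2s)} ). -/

import Mathlib

open scoped BigOperators ENNReal NNReal
open MeasureTheory ProbabilityTheory Matrix

noncomputable section

/-- Univariate forward difference matrix `D^{(1)}_M ∈ ℝ^{(M-1)×M}`, with entries
`(D^{(1)}_M)_{i,i} = -1`, `(D^{(1)}_M)_{i,i+1} = 1` and `0` otherwise. -/
def D1 (M : ℕ) : Matrix (Fin (M - 1)) (Fin M) ℝ :=
  Matrix.of fun i j => if (j : ℕ) = (i : ℕ) then -1 else if (j : ℕ) = (i : ℕ) + 1 then 1 else 0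

/-- Univariate difference operator of order `m` on `N` points:
`D^{(0)}_N = I_N` and `D^{(m+1)}_N = D^{(1)}_{N-m} D^{(m)}_N`.  In particular
`Dop N (k+1)` is the operator `D_N^{(k+1)} ∈ ℝ^{(N-k-1) × N}`. -/
def Dop (N : ℕ) : (m : ℕ) → Matrix (Fin (N - m)) (Fin N) ℝ
  | 0 => Matrix.of fun i j => if (i : ℕ) = (j : ℕ) then 1 else 0
  | m + 1 => D1 (N - m) * Dop N m

/-- Row index type of the order-`m` KTF penalty matrix: a coordinate direction `j`,
a row index of the univariate operator, and the values of the other `d-1` lattice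
coordinates. -/
abbrev KtfIdx (N d m : ℕ) :=
  Σ j : Fin d, Fin (N - m) × ({l : Fin d // l ≠ j} → Fin N)

/-- Order-`m` KTF penalty matrix on the lattice `{1,…,N}^d`: the vertical block
concatenation over coordinate directions `j` of `I_N ⊗ ⋯ ⊗ D^{(m)}_N ⊗ ⋯ ⊗ I_N`
(`D^{(m)}_N` in the `j`-th factor). -/
def ktfMat (N d m : ℕ) : Matrix (KtfIdx N d m) (Fin d → Fin N) ℝ :=
  Matrix.of fun p x =>
    Dop N m p.2.1 (x p.1) *
      ∏ l : {l : Fin d // l ≠ p.1}, (if p.2.2 l = x l.1 then (1:ℝ) else 0)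

/-- Product Gaussian measure with coordinatewise means `θ0` and variance `σ^2`. -/
def gaussSeq {ι : Type*} [Fintype ι] (θ0 : ι → ℝ) (σ : ℝ) : Measure (ι → ℝ) :=
  Measure.pi fun i => gaussianReal (θ0 i) (Real.toNNReal (σ ^ 2))

/-- Normalized expected squared error `(1/n) E‖θhat(y) - θ0‖₂²` of the estimator
`θhat` when `y` has independent `N(θ0 i, σ²)` coordinates (value in `ℝ≥0∞`). -/
def riskE {ι : Type*} [Fintype ι] (θhat : (ι → ℝ) → ι → ℝ) (θ0 : ι → ℝ) (σ : ℝ) : ℝ≥0∞ :=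
  (Fintype.card ι : ℝ≥0∞)⁻¹ * ∫⁻ y, ENNReal.ofReal (∑ i, (θhat y i - θ0 i) ^ 2) ∂(gaussSeq θ0 σ)

theorem fwdDiff_nat_eq_sum (h : ℕ) (G : ℕ → ℝ) (x : ℕ) :
    fwdDiff h G x = ∑ a ∈ Finset.range h, fwdDiff 1 G (x + a) := by
  simp only [fwdDiff, add_assoc]
  rw [Finset.sum_range_sub (fun a => G (x + a))]
  simp

theorem fwdDiff_commute_iterate (h : ℕ) (m : ℕ) (G : ℕ → ℝ) :
    (fwdDiff 1)^[m] (fwdDiff h G) = fwdDiff h ((fwdDiff 1)^[m] G) := by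
  have hc : Function.Commute (fwdDiff (1 : ℕ) : (ℕ → ℝ) → ℕ → ℝ) (fwdDiff h) := by
    intro G
    funext x
    simp only [fwdDiff]
    rw [add_right_comm]
    ring
  exact (hc.iterate_left m) G

theorem abs_fwdDiff_iter_le (h : ℕ) (hh : 1 ≤ h) (k : ℕ) (G : ℕ → ℝ) (x : ℕ) :
    |(fwdDiff h)^[k + 1] G x| ≤
      (h : ℝ) ^ k * ∑ y ∈ Finset.range ((k + 1) * (h - 1) + 1), |(fwdDiff 1)^[k + 1] G (x + y)| := by
  induction k generalizing G with
  | zero =>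
    simp only [zero_add, Function.iterate_one, pow_zero, one_mul, Nat.sub_add_cancel hh]
    rw [fwdDiff_nat_eq_sum]
    exact Finset.abs_sum_le_sum_abs _ _
  | succ k ih =>
    rw [Function.iterate_succ_apply]
    refine (ih (fwdDiff h G)).trans ?_
    rw [fwdDiff_commute_iterate, pow_succ, mul_assoc]
    gcongr
    calc ∑ y ∈ Finset.range ((k + 1) * (h - 1) + 1), |fwdDiff h ((fwdDiff 1)^[k + 1] G) (x + y)|
        ≤ ∑ y ∈ Finset.range ((k + 1) * (h - 1) + 1), ∑ a ∈ Finset.range h,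
            |(fwdDiff 1)^[k + 1 + 1] G (x + y + a)| := by
          refine Finset.sum_le_sum fun y _ => ?_
          rw [fwdDiff_nat_eq_sum, Function.iterate_succ_apply' _ (k + 1)]
          exact Finset.abs_sum_le_sum_abs _ _
      _ = ∑ a ∈ Finset.range h, ∑ y ∈ Finset.range ((k + 1) * (h - 1) + 1),
            |(fwdDiff 1)^[k + 1 + 1] G (x + y + a)| := Finset.sum_comm
      _ ≤ ∑ _a ∈ Finset.range h, ∑ y ∈ Finset.range ((k + 1 + 1) * (h - 1) + 1),
            |(fwdDiff 1)^[k + 1 + 1] G (x + y)| := by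
          refine Finset.sum_le_sum fun a ha => ?_
          rw [Finset.mem_range] at ha
          have hinj : Set.InjOn (fun y => y + a) (Finset.range ((k + 1) * (h - 1) + 1) : Set ℕ) :=
            fun _ _ _ _ h => Nat.add_right_cancel h
          calc _ = ∑ z ∈ (Finset.range ((k + 1) * (h - 1) + 1)).image (fun y => y + a),
                |(fwdDiff 1)^[k + 1 + 1] G (x + z)| := by
                rw [Finset.sum_image hinj]
                simp only [add_assoc]
            _ ≤ _ := by
                refine Finset.sum_le_sum_of_subset_of_nonneg ?_ fun _ _ _ => abs_nonneg _
                intro z hz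
                simp only [Finset.mem_image, Finset.mem_range] at hz ⊢
                obtain ⟨y, hy, rfl⟩ := hz
                rw [add_mul (k + 1) 1 (h - 1)]
                omega
      _ = _ := by simp

theorem sq_fwdDiff_iter_le (h : ℕ) (hh : 1 ≤ h) (k : ℕ) (G : ℕ → ℝ) :
    ((fwdDiff h)^[k + 1] G 0) ^ 2 ≤
      (k + 1) * (h : ℝ) ^ (2 * k + 1) *
        ∑ y ∈ Finset.range ((k + 1) * (h - 1) + 1), ((fwdDiff 1)^[k + 1] G y) ^ 2 := by
  set M := (k + 1) * (h - 1) + 1 with hM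
  have h1 := abs_fwdDiff_iter_le h hh k G 0
  simp only [zero_add] at h1
  have hMle : (M : ℝ) ≤ (k + 1) * h := by
    have : M ≤ (k + 1) * h := by
      obtain ⟨e, rfl⟩ := Nat.exists_eq_add_of_le' hh
      simp only [hM, Nat.add_sub_cancel]
      nlinarith
    exact_mod_cast this
  have h2 := sq_sum_le_card_mul_sum_sq (s := Finset.range M) (f := fun y => |(fwdDiff 1)^[k + 1] G y|)
  simp only [sq_abs, Finset.card_range] at h2
  calc ((fwdDiff h)^[k + 1] G 0) ^ 2 = |(fwdDiff h)^[k + 1] G 0| ^ 2 := (sq_abs _).symm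
    _ ≤ ((h : ℝ) ^ k * ∑ y ∈ Finset.range M, |(fwdDiff 1)^[k + 1] G y|) ^ 2 := by
        gcongr
    _ = (h : ℝ) ^ (2 * k) * (∑ y ∈ Finset.range M, |(fwdDiff 1)^[k + 1] G y|) ^ 2 := by ring
    _ ≤ (h : ℝ) ^ (2 * k) * (M * ∑ y ∈ Finset.range M, ((fwdDiff 1)^[k + 1] G y) ^ 2) := by gcongr
    _ ≤ (h : ℝ) ^ (2 * k) * (((k + 1) * h) * ∑ y ∈ Finset.range M, ((fwdDiff 1)^[k + 1] G y) ^ 2) := by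
        gcongr
    _ = _ := by ring

theorem sq_le_fwdDiff_iter_add_sum (m h : ℕ) (G : ℕ → ℝ) :
    (G 0) ^ 2 ≤ (m + 1) * 4 ^ m *
      (((fwdDiff h)^[m] G 0) ^ 2 + ∑ i ∈ Finset.range m, (G ((i + 1) * h)) ^ 2) := by
  have h1 := fwdDiff_iter_eq_sum_shift h G m 0
  rw [Finset.sum_range_succ'] at h1
  simp only [zero_add, Nat.sub_zero, Nat.choose_zero_right, Nat.cast_one, mul_one,
    zsmul_eq_mul, Int.cast_mul, Int.cast_pow, Int.cast_neg, Int.cast_one, Int.cast_natCast,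
    smul_eq_mul] at h1
  set c : ℕ → ℝ := fun i => (-1) ^ (m - (i + 1)) * (m.choose (i + 1) : ℝ) with hc
  have hcsq : ∀ i, c i ^ 2 ≤ 4 ^ m := by
    intro i
    have : (m.choose (i + 1) : ℝ) ≤ 2 ^ m := by exact_mod_cast Nat.choose_le_two_pow m (i + 1)
    calc c i ^ 2 = (m.choose (i + 1) : ℝ) ^ 2 := by
          simp only [hc, mul_pow, ← pow_mul, mul_comm _ 2]
          simp
      _ ≤ (2 ^ m) ^ 2 := by gcongr
      _ = 4 ^ m := by rw [← pow_mul, mul_comm, pow_mul]; norm_num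
  have h2 : (G 0) ^ 2 = ((fwdDiff h)^[m] G 0 - ∑ i ∈ Finset.range m, c i * G ((i + 1) * h)) ^ 2 := by
    rw [h1]
    simp only [hc, add_sub_cancel_left, mul_pow, ← pow_mul, mul_comm m 2]
    simp
  set w : ℕ → ℝ := fun i => if i = m then (fwdDiff h)^[m] G 0 else -(c i * G ((i + 1) * h)) with hw
  have hws : ∀ φ : ℝ → ℝ, ∑ i ∈ Finset.range (m + 1), φ (w i) =
      ∑ i ∈ Finset.range m, φ (-(c i * G ((i + 1) * h))) + φ ((fwdDiff h)^[m] G 0) := by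
    intro φ
    rw [Finset.sum_range_succ]
    congr 1
    · refine Finset.sum_congr rfl fun i hi => ?_
      rw [hw]; simp only [if_neg (Finset.mem_range.mp hi).ne]
    · simp [hw]
  have h3 := sq_sum_le_card_mul_sum_sq (s := Finset.range (m + 1)) (f := w)
  have e1 := hws id
  have e2 := hws (fun z => z ^ 2)
  simp only [id] at e1
  rw [e1, e2, Finset.card_range] at h3
  have h4 : ∑ i ∈ Finset.range m, (-(c i * G ((i + 1) * h))) ^ 2 ≤
      4 ^ m * ∑ i ∈ Finset.range m, (G ((i + 1) * h)) ^ 2 := by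
    rw [Finset.mul_sum]
    refine Finset.sum_le_sum fun i _ => ?_
    rw [neg_sq, mul_pow]
    gcongr
    exact hcsq i
  have h5 : ((fwdDiff h)^[m] G 0) ^ 2 ≤ 4 ^ m * ((fwdDiff h)^[m] G 0) ^ 2 :=
    le_mul_of_one_le_left (sq_nonneg _) (one_le_pow₀ (by norm_num))
  rw [h2]
  calc _ = (∑ i ∈ Finset.range m, -(c i * G ((i + 1) * h)) + (fwdDiff h)^[m] G 0) ^ 2 := by
        rw [Finset.sum_neg_distrib]; ring
    _ ≤ _ := h3
    _ ≤ ((m + 1 : ℕ) : ℝ) * (4 ^ m * ∑ i ∈ Finset.range m, (G ((i + 1) * h)) ^ 2 +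
          4 ^ m * ((fwdDiff h)^[m] G 0) ^ 2) := by gcongr
    _ = _ := by push_cast; ring

/-- One-sided discrete Sobolev inequality. -/
theorem mul_sq_le_window (k H : ℕ) (G : ℕ → ℝ) :
    H * (G 0) ^ 2 ≤ ((k + 1 + 1) * 4 ^ (k + 1) * (k + 1)) *
      (∑ y ∈ Finset.range ((k + 1) * H + 1), (G y) ^ 2 +
        (H : ℝ) ^ (2 * (k + 1)) *
          ∑ y ∈ Finset.range ((k + 1) * (H - 1) + 1), ((fwdDiff 1)^[k + 1] G y) ^ 2) := by
  set A := ∑ y ∈ Finset.range ((k + 1) * H + 1), (G y) ^ 2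
  set B := ∑ y ∈ Finset.range ((k + 1) * (H - 1) + 1), ((fwdDiff 1)^[k + 1] G y) ^ 2
  have hB : 0 ≤ B := Finset.sum_nonneg fun _ _ => sq_nonneg _
  have hstep : ∀ h ∈ Finset.Icc 1 H, (G 0) ^ 2 ≤ (k + 1 + 1) * 4 ^ (k + 1) *
      ((k + 1) * (H : ℝ) ^ (2 * k + 1) * B + ∑ i ∈ Finset.range (k + 1), (G ((i + 1) * h)) ^ 2) := by
    intro h hh
    rw [Finset.mem_Icc] at hh
    have h1 := sq_le_fwdDiff_iter_add_sum (k + 1) h G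
    push_cast at h1
    refine h1.trans ?_
    gcongr
    refine (sq_fwdDiff_iter_le h hh.1 k G).trans ?_
    have hhH : (h : ℝ) ≤ H := by exact_mod_cast hh.2
    gcongr ?_ * ?_
    · gcongr
    · refine Finset.sum_le_sum_of_subset_of_nonneg ?_ fun _ _ _ => sq_nonneg _
      refine Finset.range_mono ?_
      have := hh.2
      gcongr
  have hs := Finset.sum_le_sum hstep
  rw [Finset.sum_const, Nat.card_Icc, Nat.add_sub_cancel, nsmul_eq_mul, ← Finset.mul_sum,
    Finset.sum_add_distrib, Finset.sum_const, Nat.card_Icc, Nat.add_sub_cancel, nsmul_eq_mul,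
    Finset.sum_comm] at hs
  have hA : ∑ i ∈ Finset.range (k + 1), ∑ h ∈ Finset.Icc 1 H, (G ((i + 1) * h)) ^ 2 ≤
      (k + 1) * A := by
    calc _ ≤ ∑ _i ∈ Finset.range (k + 1), A := by
          refine Finset.sum_le_sum fun i hi => ?_
          have hinj : Set.InjOn (fun h => (i + 1) * h) (Finset.Icc 1 H : Set ℕ) :=
            fun _ _ _ _ h => Nat.eq_of_mul_eq_mul_left (Nat.succ_pos i) h
          rw [← Finset.sum_image (f := fun y => (G y) ^ 2) hinj]
          refine Finset.sum_le_sum_of_subset_of_nonneg ?_ fun _ _ _ => sq_nonneg _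
          intro z hz
          simp only [Finset.mem_image, Finset.mem_Icc, Finset.mem_range] at hz hi ⊢
          obtain ⟨h, hh, rfl⟩ := hz
          exact Nat.lt_succ_of_le (Nat.mul_le_mul (by omega) hh.2)
      _ = _ := by simp
  refine hs.trans ?_
  calc _ ≤ (k + 1 + 1) * 4 ^ (k + 1) *
        (H * ((k + 1) * (H : ℝ) ^ (2 * k + 1) * B) + (k + 1) * A) := by gcongr
    _ = _ := by ring

/-- Extension of a finite sequence by zero to all integers. -/
def zeroPad {M : ℕ} (g : Fin M → ℝ) (z : ℤ) : ℝ :=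
  ∑ i : Fin M, if (i : ℤ) = z then g i else 0

theorem zeroPad_coe {M : ℕ} (g : Fin M → ℝ) (i : Fin M) : zeroPad g (i : ℕ) = g i := by
  simp only [zeroPad, Nat.cast_inj, Fin.val_inj]
  simp

theorem zeroPad_eq_zero {M : ℕ} (g : Fin M → ℝ) {z : ℤ} (hz : z < 0 ∨ (M : ℤ) ≤ z) :
    zeroPad g z = 0 :=
  Finset.sum_eq_zero fun i _ => if_neg (by have := i.2; omega)

theorem sum_zeroPad_sq_le {M : ℕ} (g : Fin M → ℝ) {ι : Type*} (s : Finset ι) (e : ι → ℤ)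
    (he : Set.InjOn e s) : ∑ y ∈ s, (zeroPad g (e y)) ^ 2 ≤ ∑ i, (g i) ^ 2 := by
  have h1 : ∑ i, (g i) ^ 2 = ∑ z ∈ Finset.univ.image (fun i : Fin M => ((i : ℕ) : ℤ)),
      (zeroPad g z) ^ 2 := by
    rw [Finset.sum_image]
    · simp only [zeroPad_coe]
    · intro a _ b _ hab
      simpa [Fin.val_inj] using hab
  rw [h1, ← Finset.sum_image (f := fun z => (zeroPad g z) ^ 2) he]
  classical
  have h2 : ∑ z ∈ (s.image e).filter (fun z => 0 ≤ z ∧ z < (M : ℤ)), (zeroPad g z) ^ 2 =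
      ∑ z ∈ s.image e, (zeroPad g z) ^ 2 := by
    refine Finset.sum_filter_of_ne fun z _ hz => ?_
    by_contra hcon
    exact hz (by rw [zeroPad_eq_zero g (by omega)]; simp)
  rw [← h2]
  refine Finset.sum_le_sum_of_subset_of_nonneg ?_ fun _ _ _ => sq_nonneg _
  intro z hz
  simp only [Finset.mem_filter, Finset.mem_image, Finset.mem_univ, true_and] at hz ⊢
  exact ⟨⟨z.toNat, by omega⟩, by simp; omega⟩

theorem D1_mulVec (M : ℕ) (f : Fin M → ℝ) (r : Fin (M - 1)) :
    (D1 M).mulVec f r = f ⟨r + 1, by omega⟩ - f ⟨r, by omega⟩ := by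
  have h : ∀ j : Fin M, D1 M r j * f j =
      (if j = ⟨r + 1, by omega⟩ then f j else 0) - (if j = ⟨r, by omega⟩ then f j else 0) := by
    intro j
    simp only [D1, Matrix.of_apply, Fin.ext_iff]
    split_ifs <;> first | omega | simp
  simp only [Matrix.mulVec, dotProduct, h, Finset.sum_sub_distrib]
  simp

theorem Dop_zero (N : ℕ) : Dop N 0 = (1 : Matrix (Fin N) (Fin N) ℝ) := by
  ext i j
  rw [Matrix.one_apply]
  simp only [Dop, Matrix.of_apply, Fin.ext_iff]

theorem Dop_mulVec (N m : ℕ) (f : Fin N → ℝ) (r : Fin (N - m)) :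
    (Dop N m).mulVec f r = (fwdDiff 1)^[m] (zeroPad f) (r : ℕ) := by
  induction m with
  | zero =>
    rw [Dop_zero]
    exact (congrFun (Matrix.one_mulVec f) r).trans (zeroPad_coe f r).symm
  | succ m ih =>
    rw [Function.iterate_succ_apply', fwdDiff]
    have : (Dop N (m + 1)).mulVec f = (D1 (N - m)).mulVec ((Dop N m).mulVec f) := by
      rw [Matrix.mulVec_mulVec]; rfl
    rw [this]
    refine (D1_mulVec (N - m) _ r).trans ?_
    rw [ih, ih]
    push_cast
    rfl

theorem D1_transpose_mulVec (M : ℕ) (g : Fin (M - 1) → ℝ) (j : Fin M) :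
    (D1 M)ᵀ.mulVec g j = zeroPad g ((j : ℕ) - 1) - zeroPad g (j : ℕ) := by
  simp only [Matrix.mulVec, dotProduct, zeroPad, ← Finset.sum_sub_distrib]
  refine Finset.sum_congr rfl fun i _ => ?_
  simp only [D1, Matrix.transpose_apply, Matrix.of_apply]
  split_ifs <;> first | omega | simp

theorem zeroPad_D1_transpose (M : ℕ) (g : Fin (M - 1) → ℝ) :
    zeroPad ((D1 M)ᵀ.mulVec g) = fwdDiff (-1) (zeroPad g) := by
  funext z
  simp only [fwdDiff]
  by_cases hz : 0 ≤ z ∧ z < (M : ℤ)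
  · obtain ⟨j, rfl⟩ : ∃ j : Fin M, ((j : ℕ) : ℤ) = z := ⟨⟨z.toNat, by omega⟩, by simp; omega⟩
    rw [zeroPad_coe, D1_transpose_mulVec]
    rfl
  · rw [zeroPad_eq_zero _ (by omega), zeroPad_eq_zero _ (by omega), zeroPad_eq_zero _ (by omega),
      sub_self]

theorem Dop_succ_transpose_mulVec (N m : ℕ) (g : Fin (N - (m + 1)) → ℝ) :
    (Dop N (m + 1))ᵀ.mulVec g = (Dop N m)ᵀ.mulVec ((D1 (N - m))ᵀ.mulVec g) := by
  rw [Matrix.mulVec_mulVec, ← Matrix.transpose_mul]; rfl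

theorem zeroPad_Dop_transpose (N m : ℕ) (g : Fin (N - m) → ℝ) :
    zeroPad ((Dop N m)ᵀ.mulVec g) = (fwdDiff (-1))^[m] (zeroPad g) := by
  induction m with
  | zero =>
    rw [Dop_zero, Matrix.transpose_one]
    exact congrArg zeroPad (Matrix.one_mulVec g)
  | succ m ih =>
    rw [Dop_succ_transpose_mulVec, ih, Function.iterate_succ_apply]
    congr 1
    exact zeroPad_D1_transpose (N - m) g

theorem sum_sq_le_D1_transpose (M : ℕ) (g : Fin (M - 1) → ℝ) :
    ∑ i, (g i) ^ 2 ≤ (M : ℝ) ^ 2 * ∑ i, ((D1 M)ᵀ.mulVec g i) ^ 2 := by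
  set S := ∑ i, ((D1 M)ᵀ.mulVec g i) ^ 2
  have hS : 0 ≤ S := Finset.sum_nonneg fun _ _ => sq_nonneg _
  have hg : ∀ i : Fin (M - 1), (g i) ^ 2 ≤ M * S := by
    intro i
    have h1 : ∀ n : ℕ, zeroPad g ((n : ℤ) - 1) =
        -∑ j ∈ Finset.range n, zeroPad ((D1 M)ᵀ.mulVec g) j := by
      intro n
      induction n with
      | zero => simpa using zeroPad_eq_zero g (by omega)
      | succ n ih =>
        rw [Finset.sum_range_succ, neg_add, ← ih, zeroPad_D1_transpose, fwdDiff]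
        push_cast
        rw [add_sub_cancel_right, ← sub_eq_add_neg, ← sub_eq_add_neg, sub_sub_cancel]
    have h2 := h1 (i + 1)
    push_cast at h2
    rw [add_sub_cancel_right, zeroPad_coe] at h2
    rw [h2, neg_sq]
    refine sq_sum_le_card_mul_sum_sq.trans ?_
    rw [Finset.card_range]
    gcongr
    · have := i.2; omega
    · exact sum_zeroPad_sq_le _ _ (fun j : ℕ => (j : ℤ)) (fun a _ b _ h => by simpa using h)
  calc ∑ i, (g i) ^ 2 ≤ ∑ _i : Fin (M - 1), M * S := Finset.sum_le_sum fun i _ => hg i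
    _ = ((M - 1 : ℕ) : ℝ) * (M * S) := by simp
    _ ≤ (M : ℝ) * (M * S) := by
        gcongr
        exact Nat.sub_le _ _
    _ = _ := by ring

/-- Discrete Poincaré inequality with zero boundary values. -/
theorem sum_sq_le_Dop_transpose (N m : ℕ) (g : Fin (N - m) → ℝ) :
    ∑ i, (g i) ^ 2 ≤ (N : ℝ) ^ (2 * m) * ∑ i, ((Dop N m)ᵀ.mulVec g i) ^ 2 := by
  induction m with
  | zero =>
    rw [Dop_zero, Matrix.transpose_one]
    have h := Matrix.one_mulVec (α := ℝ) (m := Fin N) g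
    change _ ≤ _ * ∑ i : Fin N, ((1 : Matrix (Fin N) (Fin N) ℝ).mulVec g i) ^ 2
    rw [h]
    simp
  | succ m ih =>
    rw [Dop_succ_transpose_mulVec]
    have h1 : ∑ i, (g i) ^ 2 ≤ ((N - m : ℕ) : ℝ) ^ 2 * ∑ i, ((D1 (N - m))ᵀ.mulVec g i) ^ 2 :=
      sum_sq_le_D1_transpose (N - m) g
    have h2 := ih ((D1 (N - m))ᵀ.mulVec g)
    refine h1.trans ?_
    calc _ ≤ (N : ℝ) ^ 2 * ((N : ℝ) ^ (2 * m) *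
          ∑ i, ((Dop N m)ᵀ.mulVec ((D1 (N - m))ᵀ.mulVec g) i) ^ 2) := by
          gcongr
          exact Nat.sub_le _ _
      _ = _ := by ring

/-- The constant in the one-dimensional Sobolev inequalities. -/
def sobolevConst (k : ℕ) : ℝ := (k + 1 + 1) * 4 ^ (k + 1) * (k + 1)

theorem sobolevConst_pos (k : ℕ) : 0 < sobolevConst k := by
  unfold sobolevConst; positivity

theorem fwdDiff_iter_comp_affine (m : ℕ) (F : ℤ → ℝ) (x e : ℤ) :
    (fwdDiff 1)^[m] (fun y : ℕ => F (x + e * y)) =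
      fun y : ℕ => (fwdDiff e)^[m] F (x + e * y) := by
  induction m with
  | zero => rfl
  | succ m ih =>
    rw [Function.iterate_succ_apply', Function.iterate_succ_apply', ih]
    funext y
    simp only [fwdDiff]
    push_cast
    rw [mul_add, mul_one, add_assoc]

theorem fwdDiff_neg_one_iter (m : ℕ) (F : ℤ → ℝ) (z : ℤ) :
    (fwdDiff (-1))^[m] F z = (-1) ^ m * (fwdDiff 1)^[m] F (z - m) := by
  induction m generalizing z with
  | zero => simp
  | succ m ih =>
    rw [Function.iterate_succ_apply', Function.iterate_succ_apply']
    simp only [fwdDiff, ih]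
    have e1 : z + -1 - (m : ℤ) = z - ((m + 1 : ℕ) : ℤ) := by push_cast; ring
    have e2 : z - ((m + 1 : ℕ) : ℤ) + 1 = z - m := by push_cast; ring
    rw [e1, e2]
    ring

theorem sobolev_Dop_transpose (N k H : ℕ) (g : Fin (N - (k + 1)) → ℝ) (x : Fin (N - (k + 1))) :
    H * (g x) ^ 2 ≤ sobolevConst k *
      (∑ i, (g i) ^ 2 + (H : ℝ) ^ (2 * (k + 1)) * ∑ i, ((Dop N (k + 1))ᵀ.mulVec g i) ^ 2) := by
  have h := mul_sq_le_window k H (fun y : ℕ => zeroPad g (((x : ℕ) : ℤ) + (-1) * y))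
  rw [fwdDiff_iter_comp_affine, ← zeroPad_Dop_transpose] at h
  simp only [Nat.cast_zero, mul_zero, add_zero, zeroPad_coe] at h
  have hinj : ∀ s : Finset ℕ, Set.InjOn (fun y : ℕ => ((x : ℕ) : ℤ) + (-1) * y) s :=
    fun s a _ b _ hab => by simpa using hab
  refine h.trans ?_
  rw [sobolevConst]
  gcongr
  · exact sum_zeroPad_sq_le g _ _ (hinj _)
  · exact sum_zeroPad_sq_le _ _ _ (hinj _)

theorem sobolev_Dop (N k H : ℕ) (hH : 2 * (k + 1) * H < N) (f : Fin N → ℝ) (x : Fin N) :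
    H * (f x) ^ 2 ≤ sobolevConst k *
      (∑ i, (f i) ^ 2 + (H : ℝ) ^ (2 * (k + 1)) * ∑ i, ((Dop N (k + 1)).mulVec f i) ^ 2) := by
  rcases Nat.eq_zero_or_pos H with rfl | hHpos
  · simp only [Nat.cast_zero, zero_mul]
    exact mul_nonneg (sobolevConst_pos k).le
      (add_nonneg (Finset.sum_nonneg fun _ _ => sq_nonneg _) (by positivity))
  have hx := x.2
  have hHm : (k + 1) * H = (k + 1) * (H - 1) + (k + 1) := by
    obtain ⟨e, rfl⟩ := Nat.exists_eq_add_of_le' hHpos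
    rw [Nat.add_sub_cancel]; ring
  rw [mul_assoc] at hH
  rcases Nat.lt_or_ge ((x : ℕ) + (k + 1) * H) N with hcase | hcase
  · have h := mul_sq_le_window k H (fun y : ℕ => zeroPad f (((x : ℕ) : ℤ) + 1 * y))
    rw [fwdDiff_iter_comp_affine] at h
    simp only [Nat.cast_zero, mul_zero, add_zero, zeroPad_coe] at h
    refine h.trans ?_
    have hD : ∀ y ∈ Finset.range ((k + 1) * (H - 1) + 1),
        ((fwdDiff 1)^[k + 1] (zeroPad f) (((x : ℕ) : ℤ) + 1 * y)) ^ 2 =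
          (zeroPad ((Dop N (k + 1)).mulVec f) (((x : ℕ) : ℤ) + 1 * y)) ^ 2 := by
      intro y hy
      rw [Finset.mem_range] at hy
      have e := Dop_mulVec N (k + 1) f ⟨x + y, by omega⟩
      rw [← zeroPad_coe ((Dop N (k + 1)).mulVec f)] at e
      push_cast at e
      rw [one_mul, e]
    rw [Finset.sum_congr rfl hD, sobolevConst]
    have hinj : ∀ s : Finset ℕ, Set.InjOn (fun y : ℕ => ((x : ℕ) : ℤ) + 1 * y) s :=
      fun s a _ b _ hab => by simpa using hab
    gcongr
    · exact sum_zeroPad_sq_le f _ _ (hinj _)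
    · exact sum_zeroPad_sq_le _ _ _ (hinj _)
  · have h := mul_sq_le_window k H (fun y : ℕ => zeroPad f (((x : ℕ) : ℤ) + (-1) * y))
    rw [fwdDiff_iter_comp_affine] at h
    simp only [Nat.cast_zero, mul_zero, add_zero, zeroPad_coe] at h
    refine h.trans ?_
    have hD : ∀ y ∈ Finset.range ((k + 1) * (H - 1) + 1),
        ((fwdDiff (-1))^[k + 1] (zeroPad f) (((x : ℕ) : ℤ) + (-1) * y)) ^ 2 =
          (zeroPad ((Dop N (k + 1)).mulVec f)
            (((x : ℕ) : ℤ) - (k + 1 : ℕ) + (-1) * y)) ^ 2 := by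
      intro y hy
      rw [Finset.mem_range] at hy
      have e := Dop_mulVec N (k + 1) f ⟨x - (k + 1) - y, by omega⟩
      rw [← zeroPad_coe ((Dop N (k + 1)).mulVec f)] at e
      have e2 : ((x - (k + 1) - y : ℕ) : ℤ) = ((x : ℕ) : ℤ) - (k + 1 : ℕ) + (-1) * y := by
        omega
      simp only [e2] at e
      have e3 : ((x : ℕ) : ℤ) + (-1) * y - (k + 1 : ℕ) =
        ((x : ℕ) : ℤ) - (k + 1 : ℕ) + (-1) * y := by ring
      rw [e, fwdDiff_neg_one_iter, e3, mul_pow, ← pow_mul, mul_comm (k + 1) 2, pow_mul]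
      simp
    rw [Finset.sum_congr rfl hD, sobolevConst]
    have hinj : ∀ (c : ℤ) (s : Finset ℕ), Set.InjOn (fun y : ℕ => c + (-1) * (y : ℤ)) s :=
      fun c s a _ b _ hab => by simpa using hab
    gcongr
    · exact sum_zeroPad_sq_le f _ _ (hinj _ _)
    · exact sum_zeroPad_sq_le _ _ _ (hinj _ _)

section

theorem sum_sq_linear_comb {ι κ : Type*} [Fintype ι] [Fintype κ] [DecidableEq ι]
    (w : ι → κ → ℝ) (μ : ι → ℝ)
    (hw : ∀ a b, ∑ x, w a x * w b x = if a = b then μ a else 0) (c : ι → ℝ) :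
    ∑ x, (∑ a, c a * w a x) ^ 2 = ∑ a, c a ^ 2 * μ a := by
  calc ∑ x, (∑ a, c a * w a x) ^ 2
      = ∑ x, ∑ a, ∑ b, c a * c b * (w a x * w b x) := by
        refine Finset.sum_congr rfl fun x _ => ?_
        rw [sq, Finset.sum_mul_sum]
        refine Finset.sum_congr rfl fun a _ => Finset.sum_congr rfl fun b _ => ?_
        ring
    _ = ∑ a, ∑ b, c a * c b * ∑ x, w a x * w b x := by
        rw [Finset.sum_comm]
        refine Finset.sum_congr rfl fun a _ => ?_
        rw [Finset.sum_comm]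
        simp only [Finset.mul_sum]
    _ = _ := by
        refine Finset.sum_congr rfl fun a _ => ?_
        simp only [hw, mul_ite, mul_zero, Finset.sum_ite_eq, Finset.mem_univ, if_true]
        ring

theorem mulVec_linear_comb {κ ι τ : Type*} [Fintype ι] [Fintype τ] (D : Matrix κ ι ℝ)
    (φ : τ → ι → ℝ) (c : τ → ℝ) (r : κ) :
    D.mulVec (fun x => ∑ a, c a * φ a x) r = ∑ a, c a * D.mulVec (φ a) r := by
  simp only [Matrix.mulVec, dotProduct, Finset.mul_sum]
  rw [Finset.sum_comm]
  exact Finset.sum_congr rfl fun a _ => Finset.sum_congr rfl fun x _ => by ring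

/-- `φ` is an orthonormal basis diagonalising the quadratic form `‖D f‖²`, with values `ρ`. -/
structure IsEigenbasis {κ ι : Type*} [Fintype κ] [Fintype ι] [DecidableEq ι]
    (D : Matrix κ ι ℝ) (ρ : ι → ℝ) (φ : ι → ι → ℝ) : Prop where
  orth : ∀ a b, ∑ x, φ a x * φ b x = if a = b then 1 else 0
  gram : ∀ a b, ∑ r, D.mulVec (φ a) r * D.mulVec (φ b) r = if a = b then ρ a else 0

namespace IsEigenbasis

variable {κ ι : Type*} [Fintype κ] [Fintype ι] [DecidableEq ι]
  {D : Matrix κ ι ℝ} {ρ : ι → ℝ} {φ : ι → ι → ℝ}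

theorem of_eigenvectors (horth : ∀ a b, ∑ x, φ a x * φ b x = if a = b then 1 else 0)
    (heig : ∀ a, (Dᵀ * D).mulVec (φ a) = ρ a • φ a) : IsEigenbasis D ρ φ where
  orth := horth
  gram a b := by
    have h : ∑ r, D.mulVec (φ a) r * D.mulVec (φ b) r =
        (Dᵀ * D).mulVec (φ a) ⬝ᵥ φ b := by
      rw [← Matrix.mulVec_mulVec, Matrix.mulVec_transpose, ← Matrix.dotProduct_mulVec]
      rfl
    rw [h, heig, smul_dotProduct, smul_eq_mul]
    change ρ a * ∑ x, φ a x * φ b x = _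
    rw [horth]
    split_ifs <;> simp

theorem nonneg (h : IsEigenbasis D ρ φ) (a : ι) : 0 ≤ ρ a := by
  have := h.gram a a
  rw [if_pos rfl] at this
  rw [← this]
  exact Finset.sum_nonneg fun _ _ => mul_self_nonneg _

theorem complete (h : IsEigenbasis D ρ φ) (x y : ι) :
    ∑ a, φ a x * φ a y = if x = y then 1 else 0 := by
  have h1 : (Matrix.of φ) * (Matrix.of φ)ᵀ = 1 := by
    ext a b
    rw [Matrix.mul_apply, Matrix.one_apply, ← h.orth a b]
    rfl
  have h2 := congrFun (congrFun
    (mul_eq_one_comm.mp h1 : (Matrix.of φ)ᵀ * Matrix.of φ = 1) x) y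
  rw [Matrix.mul_apply, Matrix.one_apply] at h2
  exact h2

theorem expand (h : IsEigenbasis D ρ φ) (f : ι → ℝ) (x : ι) :
    f x = ∑ a, (∑ y, φ a y * f y) * φ a x := by
  simp only [Finset.sum_mul]
  rw [Finset.sum_comm]
  have : ∀ y, ∑ a, φ a y * f y * φ a x = (if y = x then 1 else 0) * f y := by
    intro y
    rw [← h.complete y x, Finset.sum_mul]
    exact Finset.sum_congr rfl fun a _ => by ring
  simp [this]

theorem parseval (h : IsEigenbasis D ρ φ) (f g : ι → ℝ) :
    ∑ x, f x * g x = ∑ a, (∑ x, φ a x * f x) * (∑ x, φ a x * g x) := by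
  calc ∑ x, f x * g x = ∑ x, (∑ a, (∑ y, φ a y * f y) * φ a x) * g x :=
        Finset.sum_congr rfl fun x _ => by rw [← h.expand f x]
    _ = _ := by
        simp only [Finset.sum_mul _ _ (g _), Finset.mul_sum _ _ (∑ x, φ _ x * f x)]
        rw [Finset.sum_comm]
        exact Finset.sum_congr rfl fun a _ => Finset.sum_congr rfl fun x _ => by ring

theorem eigen (h : IsEigenbasis D ρ φ) (a : ι) : Dᵀ.mulVec (D.mulVec (φ a)) = ρ a • φ a := by
  funext x
  rw [h.expand (Dᵀ.mulVec (D.mulVec (φ a))) x]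
  have : ∀ b, ∑ y, φ b y * Dᵀ.mulVec (D.mulVec (φ a)) y = if b = a then ρ b else 0 := by
    intro b
    rw [← h.gram b a]
    change φ b ⬝ᵥ Dᵀ.mulVec (D.mulVec (φ a)) = D.mulVec (φ b) ⬝ᵥ D.mulVec (φ a)
    rw [Matrix.dotProduct_mulVec, Matrix.vecMul_transpose]
  simp only [this, ite_mul, zero_mul, Finset.sum_ite_eq', Finset.mem_univ, if_true,
    Pi.smul_apply, smul_eq_mul]

theorem inner_mulVec (h : IsEigenbasis D ρ φ) (a : ι) (f : ι → ℝ) :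
    ∑ r, D.mulVec (φ a) r * D.mulVec f r = ρ a * ∑ x, φ a x * f x := by
  change D.mulVec (φ a) ⬝ᵥ D.mulVec f = _
  rw [Matrix.dotProduct_mulVec, ← Matrix.mulVec_transpose, h.eigen, smul_dotProduct]
  rfl

end IsEigenbasis

/-- The constant in the one-dimensional local eigenvalue counting bounds. -/
def weylConst (k : ℕ) : ℝ := 8 * (k + 1) * (sobolevConst k + 1)

theorem weylConst_pos (k : ℕ) : 0 < weylConst k := by
  have := sobolevConst_pos k
  unfold weylConst; positivity

theorem le_weyl_of_window (k N : ℕ) (hN : 1 ≤ N) (t S : ℝ) (ht : 0 ≤ t) (hS1 : S ≤ 1)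
    (h : ∀ H : ℕ, 2 * (k + 1) * H < N →
      H * S ≤ sobolevConst k * (1 + (H : ℝ) ^ (2 * (k + 1)) * t)) :
    S ≤ weylConst k * (t ^ (1 / (2 * ((k : ℝ) + 1))) + 1 / N) := by
  set α : ℝ := 1 / (2 * ((k : ℝ) + 1)) with hα
  have hαpos : 0 < α := by positivity
  have hC := sobolevConst_pos k
  have hNpos : (0 : ℝ) < N := by exact_mod_cast hN
  have htα : 0 ≤ t ^ α := Real.rpow_nonneg ht α
  have hk : (0 : ℝ) ≤ k := k.cast_nonneg
  have hW1 : 8 * ((k : ℝ) + 1) ≤ weylConst k := by unfold weylConst; nlinarith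
  have hWC : 8 * ((k : ℝ) + 1) * sobolevConst k ≤ weylConst k := by unfold weylConst; nlinarith
  have hW := weylConst_pos k
  rcases lt_or_ge 1 t with ht1 | ht1
  · have h1 : 1 ≤ t ^ α := Real.one_le_rpow ht1.le hαpos.le
    have h2 : 1 ≤ weylConst k := by linarith
    have h3 : 0 ≤ 1 / (N : ℝ) := by positivity
    nlinarith
  rcases Nat.lt_or_ge (2 * (k + 1)) N with hNk | hNk
  swap
  · have h1 : 1 ≤ weylConst k * (1 / N) := by
      rw [mul_one_div, le_div_iff₀ hNpos]
      have : (N : ℝ) ≤ 2 * (k + 1) := by exact_mod_cast hNk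
      linarith
    have := mul_nonneg hW.le htα
    linarith [mul_add (weylConst k) (t ^ α) (1 / (N : ℝ))]
  set H0 := (N - 1) / (2 * (k + 1)) with hH0
  have hH0pos : 1 ≤ H0 := (Nat.one_le_div_iff (by omega)).mpr (by omega)
  have hH0N : 2 * (k + 1) * H0 < N := by
    have : 2 * (k + 1) * H0 ≤ N - 1 := Nat.mul_div_le (N - 1) (2 * (k + 1))
    omega
  have hNH0 : (N : ℝ) ≤ 4 * (k + 1) * H0 := by
    have h1 : N - 1 < 2 * (k + 1) * (H0 + 1) := by
      rw [mul_comm]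
      exact Nat.lt_mul_of_div_lt (Nat.lt_succ_self _) (by omega)
    have h2 : 2 * (k + 1) * (H0 + 1) ≤ 4 * (k + 1) * H0 := by nlinarith
    have h3 : N ≤ 4 * (k + 1) * H0 := by omega
    exact_mod_cast h3
  rcases le_or_gt ((H0 : ℝ) ^ (2 * (k + 1)) * t) 1 with hcase | hcase
  · have h1 := h H0 hH0N
    have h2 : (H0 : ℝ) * S ≤ 2 * sobolevConst k := by nlinarith
    have h3 : S ≤ weylConst k * (1 / N) := by
      rw [mul_one_div, le_div_iff₀ hNpos]
      rcases le_or_gt S 0 with hS | hS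
      · nlinarith
      · calc S * N ≤ S * (4 * (k + 1) * H0) := by gcongr
          _ = 4 * (k + 1) * (H0 * S) := by ring
          _ ≤ 4 * (k + 1) * (2 * sobolevConst k) := by gcongr
          _ = 8 * (k + 1) * sobolevConst k := by ring
          _ ≤ _ := hWC
    have := mul_nonneg hW.le htα
    linarith [mul_add (weylConst k) (t ^ α) (1 / (N : ℝ))]
  · have htpos : 0 < t := by
      rcases ht.eq_or_lt with h0 | h0
      · rw [← h0] at hcase; norm_num at hcase
      · exact h0
    have htαpos : 0 < t ^ α := Real.rpow_pos_of_pos htpos α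
    have htα1 : t ^ α ≤ 1 := Real.rpow_le_one ht ht1 hαpos.le
    have hpow : (t ^ α) ^ (2 * (k + 1)) = t := by
      rw [← Real.rpow_natCast, ← Real.rpow_mul ht]
      have : α * ((2 * (k + 1) : ℕ) : ℝ) = 1 := by rw [hα]; push_cast; field_simp
      rw [this, Real.rpow_one]
    set u := (t ^ α)⁻¹ with hu
    have hu1 : 1 ≤ u := (one_le_inv₀ htαpos).mpr htα1
    have hupos : 0 < u := by positivity
    set H := ⌊u⌋₊ with hH
    have hHu : (H : ℝ) ≤ u := Nat.floor_le hupos.le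
    have hH1 : 1 ≤ H := Nat.le_floor (by simpa using hu1)
    have huH : u < H + 1 := Nat.lt_floor_add_one u
    have hut : u ^ (2 * (k + 1)) * t = 1 := by
      rw [hu, inv_pow, hpow, inv_mul_cancel₀ htpos.ne']
    have huH0 : u < H0 := by
      have : u ^ (2 * (k + 1)) * t < (H0 : ℝ) ^ (2 * (k + 1)) * t := by rw [hut]; exact hcase
      exact lt_of_pow_lt_pow_left₀ _ (by positivity) (lt_of_mul_lt_mul_right this ht)
    have hHH0 : H ≤ H0 := by
      have : (H : ℝ) ≤ H0 := hHu.trans huH0.le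
      exact_mod_cast this
    have h1 := h H (lt_of_le_of_lt (Nat.mul_le_mul_left _ hHH0) hH0N)
    have hHt : (H : ℝ) ^ (2 * (k + 1)) * t ≤ 1 := by
      rw [← hut]; gcongr
    have h2 : (H : ℝ) * S ≤ 2 * sobolevConst k := by nlinarith
    have hH1' : (1 : ℝ) ≤ H := by exact_mod_cast hH1
    have h3 : S ≤ weylConst k * t ^ α := by
      rcases le_or_gt S 0 with hS | hS
      · have := mul_nonneg hW.le htα; linarith
      · have h4 : u * S ≤ 4 * sobolevConst k := by nlinarith
        have h5 : S = (u * S) * t ^ α := by rw [hu]; field_simp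
        rw [h5]
        gcongr
        nlinarith
    have : 0 ≤ weylConst k * (1 / (N : ℝ)) := by positivity
    linarith [mul_add (weylConst k) (t ^ α) (1 / (N : ℝ))]

variable {N k : ℕ} {ρ : Fin N → ℝ} {φ : Fin N → Fin N → ℝ}

/-- Local eigenvalue counting bound for the eigenvectors of `DᵀD`. -/
theorem local_weyl_right (h : IsEigenbasis (Dop N (k + 1)) ρ φ) (t : ℝ) (ht : 0 ≤ t) (x : Fin N) :
    ∑ a with ρ a ≤ t, (φ a x) ^ 2 ≤ weylConst k * (t ^ (1 / (2 * ((k : ℝ) + 1))) + 1 / N) := by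
  set S := ∑ a with ρ a ≤ t, (φ a x) ^ 2 with hS
  have hS0 : 0 ≤ S := Finset.sum_nonneg fun _ _ => sq_nonneg _
  have hS1 : S ≤ 1 := by
    have := h.complete x x
    rw [if_pos rfl] at this
    rw [← this]
    simp only [← sq]
    exact Finset.sum_le_sum_of_subset_of_nonneg (Finset.filter_subset _ _)
      fun _ _ _ => sq_nonneg _
  rcases hS0.eq_or_lt with h0 | hpos
  · rw [← h0]
    have := weylConst_pos k
    positivity
  refine le_weyl_of_window k N (by have := x.2; omega) t S ht hS1 fun H hH => ?_
  set c : Fin N → ℝ := fun a => if ρ a ≤ t then φ a x else 0 with hc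
  have e1 : ∑ a, c a * φ a x = S := by
    rw [hS, Finset.sum_filter]
    exact Finset.sum_congr rfl fun a _ => by simp only [hc]; split_ifs <;> ring
  have e2 : ∑ a, c a ^ 2 * 1 = S := by
    rw [hS, Finset.sum_filter]
    exact Finset.sum_congr rfl fun a _ => by simp only [hc]; split_ifs <;> ring
  have e3 : ∑ a, c a ^ 2 * ρ a ≤ t * S := by
    rw [hS, Finset.sum_filter, Finset.mul_sum]
    refine Finset.sum_le_sum fun a _ => ?_
    simp only [hc]
    split_ifs with hat
    · nlinarith [sq_nonneg (φ a x)]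
    · simp
  have h1 := sobolev_Dop N k H hH (fun y => ∑ a, c a * φ a y) x
  simp only [mulVec_linear_comb] at h1
  rw [sum_sq_linear_comb φ 1 h.orth c, sum_sq_linear_comb _ ρ h.gram c, e1] at h1
  simp only [Pi.one_apply] at h1
  rw [e2] at h1
  have h2 : H * S ^ 2 ≤ sobolevConst k * (S + (H : ℝ) ^ (2 * (k + 1)) * (t * S)) := by
    refine h1.trans ?_
    have := (sobolevConst_pos k).le
    gcongr
  refine le_of_mul_le_mul_right ?_ hpos
  linarith

/-- Local eigenvalue counting bound for the left singular vectors `D φ_a / √ρ_a`. -/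
theorem local_weyl_left (h : IsEigenbasis (Dop N (k + 1)) ρ φ) (t : ℝ) (ht : 0 ≤ t)
    (r : Fin (N - (k + 1))) :
    ∑ a with ρ a ≤ t, ((Dop N (k + 1)).mulVec (φ a) r) ^ 2 / ρ a ≤
      weylConst k * (t ^ (1 / (2 * ((k : ℝ) + 1))) + 1 / N) := by
  set w : Fin N → Fin (N - (k + 1)) → ℝ := fun a => (Dop N (k + 1)).mulVec (φ a) with hw
  set S := ∑ a with ρ a ≤ t, (w a r) ^ 2 / ρ a with hS
  have hS0 : 0 ≤ S := Finset.sum_nonneg fun a _ => div_nonneg (sq_nonneg _) (h.nonneg a)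
  rcases hS0.eq_or_lt with h0 | hpos
  · rw [← h0]
    have := weylConst_pos k
    positivity
  set c : Fin N → ℝ := fun a => if ρ a ≤ t then w a r / ρ a else 0 with hc
  set g : Fin (N - (k + 1)) → ℝ := fun y => ∑ a, c a * w a y with hg
  have e1 : g r = S := by
    rw [hS, Finset.sum_filter]
    exact Finset.sum_congr rfl fun a _ => by simp only [hc]; split_ifs <;> ring
  have e2 : ∑ y, g y ^ 2 = S := by
    rw [sum_sq_linear_comb w ρ h.gram c, hS, Finset.sum_filter]
    refine Finset.sum_congr rfl fun a _ => ?_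
    simp only [hc]
    rcases eq_or_ne (ρ a) 0 with hz | hz
    · simp [hz]
    · split_ifs <;> field_simp
      simp
  have e3 : (Dop N (k + 1))ᵀ.mulVec g = fun x => ∑ a, (c a * ρ a) * φ a x := by
    have : g = ∑ a, c a • w a := by
      funext y; simp [hg]
    rw [this, Matrix.mulVec_sum]
    funext x
    simp only [Matrix.mulVec_smul, hw, h.eigen, Finset.sum_apply, Pi.smul_apply, smul_eq_mul,
      mul_assoc]
  have e4 : ∑ x, ((Dop N (k + 1))ᵀ.mulVec g x) ^ 2 ≤ t * S := by
    rw [e3, sum_sq_linear_comb φ 1 h.orth, hS, Finset.sum_filter, Finset.mul_sum]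
    refine Finset.sum_le_sum fun a _ => ?_
    simp only [hc]
    split_ifs with hat
    · rcases eq_or_ne (ρ a) 0 with hz | hz
      · simp [hz]
      · have hρ : 0 < ρ a := lt_of_le_of_ne (h.nonneg a) hz.symm
        have : (w a r / ρ a * ρ a) ^ 2 * (1 : Fin N → ℝ) a = ρ a * ((w a r) ^ 2 / ρ a) := by
          rw [Pi.one_apply]; field_simp
        rw [this]
        gcongr
    · simp
  have hS1 : S ≤ 1 := by
    have h1 : (g r) ^ 2 ≤ ∑ y, g y ^ 2 :=
      Finset.single_le_sum (f := fun y => g y ^ 2) (fun _ _ => sq_nonneg _) (Finset.mem_univ r)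
    rw [e1, e2] at h1
    nlinarith
  refine le_weyl_of_window k N (by have := r.2; omega) t S ht hS1 fun H _ => ?_
  have h1 := sobolev_Dop_transpose N k H g r
  rw [e1, e2] at h1
  have h2 : H * S ^ 2 ≤ sobolevConst k * (S + (H : ℝ) ^ (2 * (k + 1)) * (t * S)) := by
    refine h1.trans ?_
    have := (sobolevConst_pos k).le
    gcongr
  refine le_of_mul_le_mul_right ?_ hpos
  linarith

end

theorem sum_range_geometric_le {x : ℝ} (h0 : 0 ≤ x) (h1 : x < 1) (M : ℕ) :
    ∑ q ∈ Finset.range M, x ^ q ≤ (1 - x)⁻¹ := by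
  rw [← tsum_geometric_of_lt_one h0 h1]
  exact (summable_geometric_of_lt_one h0 h1).sum_le_tsum _ fun _ _ => pow_nonneg h0 _

/-- Shell decomposition of a weighted sum of reciprocals. -/
theorem sum_div_le_of_shells {ι : Type*} (I : Finset ι) (W ξ : ι → ℝ)
    (hW : ∀ i ∈ I, 0 ≤ W i) (T A : ℕ → ℝ) (hT : ∀ q, 0 < T q)
    (hcov : ∀ i ∈ I, ∃ q, ξ i ≤ T q ∧ T q ≤ 2 * ξ i)
    (hmass : ∀ q, ∑ i ∈ I with ξ i ≤ T q, W i ≤ A q) (B : ℝ)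
    (hB : ∀ M, ∑ q ∈ Finset.range M, 2 * A q / T q ≤ B) :
    ∑ i ∈ I, W i / ξ i ≤ B := by
  classical
  choose! s hs using hcov
  refine le_trans ?_ (hB (I.sup s + 1))
  rw [← Finset.sum_fiberwise_of_maps_to (g := s) (t := Finset.range (I.sup s + 1))
    (fun i hi => Finset.mem_range.mpr (Nat.lt_succ_of_le (Finset.le_sup hi)))]
  refine Finset.sum_le_sum fun q _ => ?_
  have h1 : ∀ i ∈ I.filter (fun i => s i = q), W i / ξ i ≤ 2 / T q * W i := by
    intro i hi
    rw [Finset.mem_filter] at hi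
    obtain ⟨hi, rfl⟩ := hi
    have := hs i hi
    have hTs := hT (s i)
    have hξ : 0 < ξ i := by linarith
    rw [div_mul_eq_mul_div, div_le_div_iff₀ hξ hTs]
    nlinarith [hW i hi]
  calc _ ≤ ∑ i ∈ I with s i = q, 2 / T q * W i := Finset.sum_le_sum h1
    _ = 2 / T q * ∑ i ∈ I with s i = q, W i := by rw [Finset.mul_sum]
    _ ≤ 2 / T q * ∑ i ∈ I with ξ i ≤ T q, W i := by
        have := hT q
        gcongr ?_ * ?_
        refine Finset.sum_le_sum_of_subset_of_nonneg ?_ fun i hi _ =>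
          hW i (Finset.mem_filter.mp hi).1
        intro i hi
        rw [Finset.mem_filter] at hi ⊢
        obtain ⟨hi, rfl⟩ := hi
        exact ⟨hi, (hs i hi).1⟩
    _ ≤ 2 / T q * A q := by
        have := hT q
        gcongr
        exact hmass q
    _ = _ := by ring

theorem sum_div_le_of_mass_lt_one {ι : Type*} [Fintype ι] (W ξ : ι → ℝ)
    (hW : ∀ i, 0 ≤ W i) (lam K γ : ℝ) (hlam : 0 < lam) (hK : 0 ≤ K) (hγ : γ < 1)
    (hmass : ∀ t, lam ≤ t → ∑ i with ξ i ≤ t, W i ≤ K * t ^ γ) :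
    ∑ i with lam ≤ ξ i, W i / ξ i ≤
      2 * K * (1 - (2 : ℝ) ^ (γ - 1))⁻¹ * lam ^ (γ - 1) := by
  have hr1 : (2 : ℝ) ^ (γ - 1) < 1 := Real.rpow_lt_one_of_one_lt_of_neg (by norm_num) (by linarith)
  have hr0 : (0 : ℝ) < 2 ^ (γ - 1) := by positivity
  have hlamge : ∀ q : ℕ, lam ≤ 2 ^ (q + 1) * lam := fun q =>
    le_mul_of_one_le_left hlam.le (one_le_pow₀ (by norm_num))
  refine sum_div_le_of_shells _ W ξ (fun i _ => hW i) (fun q => 2 ^ (q + 1) * lam)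
    (fun q => K * (2 ^ (q + 1) * lam) ^ γ) (fun q => by positivity) ?_ ?_ _ ?_
  · intro i hi
    rw [Finset.mem_filter] at hi
    obtain ⟨n, hn1, hn2⟩ := exists_nat_pow_near (x := ξ i / lam) (y := (2 : ℝ))
      ((one_le_div hlam).mpr hi.2) (by norm_num)
    rw [le_div_iff₀ hlam] at hn1
    rw [div_lt_iff₀ hlam] at hn2
    exact ⟨n, hn2.le, by rw [pow_succ]; linarith⟩
  · intro q
    refine le_trans (Finset.sum_le_sum_of_subset_of_nonneg ?_ fun i _ _ => hW i)
      (hmass _ (hlamge q))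
    exact Finset.filter_subset_filter _ (Finset.filter_subset _ _)
  · intro M
    calc ∑ q ∈ Finset.range M, 2 * (K * (2 ^ (q + 1) * lam) ^ γ) / (2 ^ (q + 1) * lam)
        = ∑ q ∈ Finset.range M, 2 * K * lam ^ (γ - 1) * 2 ^ (γ - 1) * (2 ^ (γ - 1)) ^ q := by
          refine Finset.sum_congr rfl fun q _ => ?_
          have hpos : (0 : ℝ) < 2 ^ (q + 1) * lam := by positivity
          have e1 : (2 ^ (q + 1) * lam) ^ γ / (2 ^ (q + 1) * lam) =
              (2 ^ (q + 1) * lam) ^ (γ - 1) := by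
            rw [Real.rpow_sub_one hpos.ne']
          have e2 : ((2 : ℝ) ^ (q + 1)) ^ (γ - 1) = (2 ^ (γ - 1)) ^ (q + 1) := by
            rw [← Real.rpow_natCast, ← Real.rpow_natCast, ← Real.rpow_mul (by norm_num),
              ← Real.rpow_mul (by norm_num), mul_comm]
          rw [mul_div_assoc, mul_div_assoc, e1, Real.mul_rpow (by positivity) hlam.le, e2]
          ring
      _ = 2 * K * lam ^ (γ - 1) * 2 ^ (γ - 1) * ∑ q ∈ Finset.range M, (2 ^ (γ - 1)) ^ q := by
          rw [Finset.mul_sum]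
      _ ≤ 2 * K * lam ^ (γ - 1) * 1 * (1 - (2 : ℝ) ^ (γ - 1))⁻¹ := by
          gcongr
          exact sum_range_geometric_le hr0.le hr1 M
      _ = _ := by ring

theorem sum_div_le_of_one_lt_mass {ι : Type*} [Fintype ι] (W ξ : ι → ℝ)
    (hW : ∀ i, 0 ≤ W i) (lam K γ : ℝ) (hlam : 0 < lam) (hK : 0 ≤ K) (hγ : 1 < γ)
    (htot : ∑ i, W i ≤ 1)
    (hmass : ∀ t, lam ≤ t → ∑ i with ξ i ≤ t, W i ≤ K * t ^ γ) :
    ∑ i with lam ≤ ξ i, W i / ξ i ≤ 1 + 2 * K * (1 - (2 : ℝ) ^ (1 - γ))⁻¹ := by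
  have hr1 : (2 : ℝ) ^ (1 - γ) < 1 := Real.rpow_lt_one_of_one_lt_of_neg (by norm_num) (by linarith)
  have hr0 : (0 : ℝ) < 2 ^ (1 - γ) := by positivity
  rw [← Finset.sum_filter_add_sum_filter_not _ (fun i => 1 < ξ i)]
  refine add_le_add ?_ ?_
  · calc _ ≤ ∑ i ∈ (Finset.univ.filter fun i => lam ≤ ξ i).filter (fun i => 1 < ξ i), W i := by
          refine Finset.sum_le_sum fun i hi => ?_
          exact div_le_self (hW i) (Finset.mem_filter.mp hi).2.le
      _ ≤ ∑ i, W i :=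
          Finset.sum_le_sum_of_subset_of_nonneg (Finset.subset_univ _) fun i _ _ => hW i
      _ ≤ 1 := htot
  refine sum_div_le_of_shells _ W ξ (fun i _ => hW i) (fun q => (2 ^ q)⁻¹)
    (fun q => K * ((2 ^ q)⁻¹) ^ γ) (fun q => by positivity) ?_ ?_ _ ?_
  · intro i hi
    simp only [Finset.mem_filter, Finset.mem_univ, true_and, not_lt] at hi
    have hξ : 0 < ξ i := lt_of_lt_of_le hlam hi.1
    obtain ⟨n, hn1, hn2⟩ := exists_nat_pow_near (x := (ξ i)⁻¹) (y := (2 : ℝ))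
      ((one_le_inv₀ hξ).mpr hi.2) (by norm_num)
    refine ⟨n, (le_inv_comm₀ (by positivity) hξ).mp hn1, ?_⟩
    have h2 := (inv_lt_comm₀ hξ (by positivity)).mp hn2
    rw [pow_succ, mul_inv] at h2
    linarith
  · intro q
    rcases le_or_gt lam ((2 ^ q)⁻¹) with hq | hq
    · refine le_trans (Finset.sum_le_sum_of_subset_of_nonneg ?_ fun i _ _ => hW i) (hmass _ hq)
      exact Finset.filter_subset_filter _ (Finset.subset_univ _)
    · rw [Finset.sum_eq_zero]
      · positivity
      · intro i hi
        simp only [Finset.mem_filter, Finset.mem_univ, true_and] at hi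
        linarith [hi.1.1, hi.2]
  · intro M
    calc ∑ q ∈ Finset.range M, 2 * (K * (((2 : ℝ) ^ q)⁻¹) ^ γ) / (2 ^ q)⁻¹
        = ∑ q ∈ Finset.range M, 2 * K * (2 ^ (1 - γ)) ^ q := by
          refine Finset.sum_congr rfl fun q _ => ?_
          have hpos : (0 : ℝ) < (2 ^ q)⁻¹ := by positivity
          have e1 : (((2 : ℝ) ^ q)⁻¹) ^ γ / (2 ^ q)⁻¹ = ((2 ^ q)⁻¹) ^ (γ - 1) := by
            rw [Real.rpow_sub_one hpos.ne']
          have e2 : (((2 : ℝ) ^ q)⁻¹) ^ (γ - 1) = (2 ^ (1 - γ)) ^ q := by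
            rw [← Real.rpow_natCast, ← Real.rpow_natCast, ← Real.rpow_neg (by norm_num),
              ← Real.rpow_mul (by norm_num), ← Real.rpow_mul (by norm_num)]
            congr 1; ring
          rw [mul_div_assoc, mul_div_assoc, e1, e2]
          ring
      _ = 2 * K * ∑ q ∈ Finset.range M, (2 ^ (1 - γ)) ^ q := by
          rw [Finset.mul_sum]
      _ ≤ _ := by
          gcongr
          exact sum_range_geometric_le hr0.le hr1 M

/-- Counting bound for a product of weights on multi-indices. -/
theorem sum_prod_le_of_local_weyl {d N : ℕ} (ρ : Fin N → ℝ) (hρ : ∀ a, 0 ≤ ρ a)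
    (ω : Fin d → Fin N → ℝ) (hω : ∀ l a, 0 ≤ ω l a) (t K : ℝ)
    (hK : ∀ l, ∑ a with ρ a ≤ t, ω l a ≤ K) :
    ∑ i : Fin d → Fin N with ∑ j, ρ (i j) ≤ t, ∏ l, ω l (i l) ≤ K ^ d := by
  calc ∑ i : Fin d → Fin N with ∑ j, ρ (i j) ≤ t, ∏ l, ω l (i l)
      ≤ ∑ i ∈ Fintype.piFinset (fun _ : Fin d => Finset.univ.filter (fun a => ρ a ≤ t)),
          ∏ l, ω l (i l) := by
        refine Finset.sum_le_sum_of_subset_of_nonneg ?_ fun i _ _ =>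
          Finset.prod_nonneg fun l _ => hω l _
        intro i hi
        simp only [Finset.mem_filter, Finset.mem_univ, true_and, Fintype.mem_piFinset] at hi ⊢
        exact fun l => le_trans (Finset.single_le_sum (f := fun j => ρ (i j))
          (fun j _ => hρ _) (Finset.mem_univ l)) hi
    _ = ∏ l, ∑ a with ρ a ≤ t, ω l a := (Finset.prod_univ_sum _ _).symm
    _ ≤ ∏ _l : Fin d, K := Finset.prod_le_prod
        (fun l _ => Finset.sum_nonneg fun a _ => hω l a) fun l _ => hK l
    _ = K ^ d := by simp

theorem sum_prod_pi {ι β : Type*} [Fintype ι] [DecidableEq ι] [Fintype β] (f : ι → β → ℝ) :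
    ∑ x : ι → β, ∏ l, f l (x l) = ∏ l, ∑ b, f l b := by
  rw [Finset.prod_univ_sum, Fintype.piFinset_univ]

theorem prod_eq_mul_prod_subtype_ne {ι : Type*} [Fintype ι] [DecidableEq ι] (j : ι) (g : ι → ℝ) :
    ∏ l, g l = g j * ∏ l : {l // l ≠ j}, g l := by
  rw [← Fintype.prod_subtype_mul_prod_subtype (fun l => l = j) g]
  congr 1
  convert Fintype.prod_unique fun l : {l // l = j} => g l
  exact (default : {l // l = j}).2.symm

theorem ktfMat_mulVec_prod {N d m : ℕ} (f : Fin d → Fin N → ℝ) (p : KtfIdx N d m) :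
    (ktfMat N d m).mulVec (fun x => ∏ l, f l (x l)) p =
      (Dop N m).mulVec (f p.1) p.2.1 * ∏ l : {l // l ≠ p.1}, f l (p.2.2 l) := by
  obtain ⟨j, r, rest⟩ := p
  simp only [Matrix.mulVec, dotProduct, ktfMat, Matrix.of_apply]
  rw [← Equiv.sum_comp (Equiv.funSplitAt j (Fin N)).symm, Fintype.sum_prod_type, Finset.sum_mul]
  refine Finset.sum_congr rfl fun a _ => ?_
  have h : ∀ y : {l // l ≠ j} → Fin N,
      (Dop N m r ((Equiv.funSplitAt j (Fin N)).symm (a, y) j) *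
        ∏ l : {l // l ≠ j},
          if rest l = (Equiv.funSplitAt j (Fin N)).symm (a, y) l then (1 : ℝ) else 0) *
        ∏ l, f l ((Equiv.funSplitAt j (Fin N)).symm (a, y) l) =
      Dop N m r a * f j a * ∏ l : {l // l ≠ j}, ((if rest l = y l then 1 else 0) * f l (y l)) := by
    intro y
    have hy : ∀ l : {l // l ≠ j}, (Equiv.funSplitAt j (Fin N)).symm (a, y) l = y l := by
      intro l
      simp [Equiv.funSplitAt, Equiv.piSplitAt, l.2]
    have hj : (Equiv.funSplitAt j (Fin N)).symm (a, y) j = a := by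
      simp [Equiv.funSplitAt, Equiv.piSplitAt]
    rw [prod_eq_mul_prod_subtype_ne j, Finset.prod_mul_distrib]
    simp only [hy, hj]
    ring
  have hs := sum_prod_pi fun (l : {l // l ≠ j}) b => (if rest l = b then (1 : ℝ) else 0) * f l b
  rw [Finset.sum_congr rfl fun y _ => h y, ← Finset.mul_sum, hs]
  simp

/-- The tensor products of a univariate eigenbasis form an eigenbasis of the KTF penalty. -/
theorem IsEigenbasis.tensor {N d m : ℕ} {ρ : Fin N → ℝ} {φ : Fin N → Fin N → ℝ}
    (h : IsEigenbasis (Dop N m) ρ φ) :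
    IsEigenbasis (ktfMat N d m) (fun i : Fin d → Fin N => ∑ j, ρ (i j))
      (fun i x => ∏ l, φ (i l) (x l)) where
  orth a b := by
    simp only [← Finset.prod_mul_distrib]
    rw [sum_prod_pi (fun l y => φ (a l) y * φ (b l) y)]
    simp only [h.orth]
    split_ifs with hab
    · simp [hab]
    · obtain ⟨l, hl⟩ := Function.ne_iff.mp hab
      exact Finset.prod_eq_zero (Finset.mem_univ l) (if_neg hl)
  gram a b := by
    rw [Fintype.sum_sigma]
    have hj : ∀ j : Fin d, ∑ y : Fin (N - m) × ({l // l ≠ j} → Fin N),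
        (ktfMat N d m).mulVec (fun x => ∏ l, φ (a l) (x l)) ⟨j, y⟩ *
          (ktfMat N d m).mulVec (fun x => ∏ l, φ (b l) (x l)) ⟨j, y⟩ =
        if a = b then ρ (a j) else 0 := by
      intro j
      rw [Fintype.sum_prod_type]
      have h1 : ∀ (r : Fin (N - m)) (y : {l // l ≠ j} → Fin N),
          (ktfMat N d m).mulVec (fun x => ∏ l, φ (a l) (x l)) ⟨j, r, y⟩ *
            (ktfMat N d m).mulVec (fun x => ∏ l, φ (b l) (x l)) ⟨j, r, y⟩ =
          ((Dop N m).mulVec (φ (a j)) r * (Dop N m).mulVec (φ (b j)) r) *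
            ∏ l : {l // l ≠ j}, (φ (a l) (y l) * φ (b l) (y l)) := by
        intro r y
        rw [ktfMat_mulVec_prod (fun l => φ (a l)), ktfMat_mulVec_prod (fun l => φ (b l)),
          Finset.prod_mul_distrib]
        ring
      simp only [h1, ← Finset.mul_sum]
      rw [← Finset.sum_mul, h.gram,
        sum_prod_pi (fun (l : {l // l ≠ j}) y => φ (a l) y * φ (b l) y)]
      simp only [h.orth]
      split_ifs with h2 h3 h3
      · simp [h3]
      · obtain ⟨l, hl⟩ := Function.ne_iff.mp h3
        have hlj : l ≠ j := fun e => hl (e ▸ h2)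
        rw [Finset.prod_eq_zero (Finset.mem_univ (⟨l, hlj⟩ : {l // l ≠ j})) (if_neg hl), mul_zero]
      · exact absurd (congrFun h3 j) h2
      · simp
    rw [Finset.sum_congr rfl fun j _ => hj j]
    split_ifs <;> simp

theorem IsEigenbasis.sum_sq_mulVec_div_le_one {κ ι : Type*} [Fintype κ] [Fintype ι]
    [DecidableEq ι] {D : Matrix κ ι ℝ} {ρ : ι → ℝ} {φ : ι → ι → ℝ} (h : IsEigenbasis D ρ φ)
    (r : κ) : ∑ a, (D.mulVec (φ a) r) ^ 2 / ρ a ≤ 1 := by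
  set S := ∑ a, (D.mulVec (φ a) r) ^ 2 / ρ a with hS
  set g : κ → ℝ := fun y => ∑ a, D.mulVec (φ a) r / ρ a * D.mulVec (φ a) y with hg
  have e1 : g r = S := Finset.sum_congr rfl fun a _ => by ring
  have e2 : ∑ y, g y ^ 2 = S := by
    rw [sum_sq_linear_comb (fun a => D.mulVec (φ a)) ρ h.gram]
    refine Finset.sum_congr rfl fun a _ => ?_
    rcases eq_or_ne (ρ a) 0 with hz | hz
    · simp [hz]
    · field_simp
  have h1 : (g r) ^ 2 ≤ ∑ y, g y ^ 2 :=
    Finset.single_le_sum (f := fun y => g y ^ 2) (fun _ _ => sq_nonneg _) (Finset.mem_univ r)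
  rw [e1, e2] at h1
  nlinarith

/-- Weights of the spectral measure of the KTF operator seen from a row of the penalty matrix. -/
def rowWeight {N d m : ℕ} (ρ : Fin N → ℝ) (φ : Fin N → Fin N → ℝ) (p : KtfIdx N d m)
    (l : Fin d) (a : Fin N) : ℝ :=
  if hl : l = p.1 then ((Dop N m).mulVec (φ a) p.2.1) ^ 2 / ρ a else (φ a (p.2.2 ⟨l, hl⟩)) ^ 2

section

variable {N d k : ℕ} {ρ : Fin N → ℝ} {φ : Fin N → Fin N → ℝ}

theorem rowWeight_nonneg (h : IsEigenbasis (Dop N (k + 1)) ρ φ) (p : KtfIdx N d (k + 1))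
    (l : Fin d) (a : Fin N) : 0 ≤ rowWeight ρ φ p l a := by
  unfold rowWeight
  split_ifs
  · exact div_nonneg (sq_nonneg _) (h.nonneg a)
  · exact sq_nonneg _

theorem sum_rowWeight_le (h : IsEigenbasis (Dop N (k + 1)) ρ φ) (p : KtfIdx N d (k + 1))
    (l : Fin d) (t : ℝ) (ht : 0 ≤ t) :
    ∑ a with ρ a ≤ t, rowWeight ρ φ p l a ≤
      weylConst k * (t ^ (1 / (2 * ((k : ℝ) + 1))) + 1 / N) := by
  unfold rowWeight
  split_ifs with hl
  · exact local_weyl_left h t ht p.2.1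
  · exact local_weyl_right h t ht _

theorem sq_ktfMat_mulVec_le (h : IsEigenbasis (Dop N (k + 1)) ρ φ) (p : KtfIdx N d (k + 1))
    (i : Fin d → Fin N) :
    ((ktfMat N d (k + 1)).mulVec (fun x => ∏ l, φ (i l) (x l)) p) ^ 2 ≤
      (∑ j, ρ (i j)) * ∏ l, rowWeight ρ φ p l (i l) := by
  rw [ktfMat_mulVec_prod (fun l => φ (i l)), prod_eq_mul_prod_subtype_ne p.1, mul_pow,
    ← Finset.prod_pow, ← mul_assoc]
  have h1 : ∀ l : {l // l ≠ p.1}, rowWeight ρ φ p l (i l) = (φ (i l) (p.2.2 l)) ^ 2 := by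
    intro l
    rw [rowWeight, dif_neg l.2]
  simp only [h1]
  refine mul_le_mul_of_nonneg_right ?_ (Finset.prod_nonneg fun _ _ => sq_nonneg _)
  rw [rowWeight, dif_pos rfl]
  set w := (Dop N (k + 1)).mulVec (φ (i p.1)) p.2.1 with hw
  have hle : ρ (i p.1) ≤ ∑ j, ρ (i j) := Finset.single_le_sum (f := fun j => ρ (i j))
    (fun j _ => h.nonneg _) (Finset.mem_univ p.1)
  rcases (h.nonneg (i p.1)).eq_or_lt with h0 | hpos
  · have hz : ∑ r, ((Dop N (k + 1)).mulVec (φ (i p.1)) r) ^ 2 = 0 := by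
      have := h.gram (i p.1) (i p.1)
      rw [if_pos rfl, ← h0] at this
      simpa only [sq] using this
    have := (Finset.sum_eq_zero_iff_of_nonneg fun _ _ => sq_nonneg _).mp hz p.2.1
      (Finset.mem_univ _)
    rw [hw, this]
    simp
  · calc w ^ 2 = ρ (i p.1) * (w ^ 2 / ρ (i p.1)) := by field_simp
      _ ≤ _ := by gcongr

theorem sum_rowWeight_le_one (h : IsEigenbasis (Dop N (k + 1)) ρ φ) (p : KtfIdx N d (k + 1))
    (l : Fin d) : ∑ a, rowWeight ρ φ p l a ≤ 1 := by
  unfold rowWeight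
  split_ifs with hl
  · exact h.sum_sq_mulVec_div_le_one _
  · have := h.complete (p.2.2 ⟨l, hl⟩) (p.2.2 ⟨l, hl⟩)
    simp only [sq]
    rw [this, if_pos rfl]

/-- Bound on the part of a signal with bounded KTF penalty seen by eigenvectors with
eigenvalue at least `lam`. -/
theorem bias_le (h : IsEigenbasis (Dop N (k + 1)) ρ φ)
    (v : (Fin d → Fin N) → (Fin d → Fin N) → ℝ)
    (hv : ∀ i i', ∑ x, v i x * v i' x = if i = i' then (1 : ℝ) else 0)
    (hev : ∀ i, ((ktfMat N d (k + 1))ᵀ * ktfMat N d (k + 1)).mulVec (v i) =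
          (∑ j, ρ (i j)) • v i)
    (R : Finset (Fin d → Fin N)) (lam : ℝ) (hlam : 0 < lam)
    (hR : ∀ i ∈ R, lam ≤ ∑ j, ρ (i j)) (B : ℝ) (hB0 : 0 ≤ B)
    (hB : ∀ p : KtfIdx N d (k + 1), ∑ i : Fin d → Fin N with lam ≤ ∑ j, ρ (i j),
      (∏ l, rowWeight ρ φ p l (i l)) / (∑ j, ρ (i j)) ≤ B)
    (Cn : ℝ) (θ : (Fin d → Fin N) → ℝ)
    (hθ : ∑ p, |(ktfMat N d (k + 1)).mulVec θ p| ≤ Cn) :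
    ∑ i ∈ R, (∑ x, v i x * θ x) ^ 2 ≤ Cn ^ 2 * B := by
  set D := ktfMat N d (k + 1) with hD
  set ξ : (Fin d → Fin N) → ℝ := fun i => ∑ j, ρ (i j) with hξ
  set Φ : (Fin d → Fin N) → (Fin d → Fin N) → ℝ := fun i x => ∏ l, φ (i l) (x l) with hΦ
  have hT : IsEigenbasis D ξ Φ := h.tensor
  set a : (Fin d → Fin N) → ℝ := fun i => if i ∈ R then ∑ x, v i x * θ x else 0 with ha
  set g : (Fin d → Fin N) → ℝ := fun x => ∑ i, a i * v i x with hg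
  set E := ∑ i ∈ R, (∑ x, v i x * θ x) ^ 2 with hE
  set b : (Fin d → Fin N) → ℝ := fun i => ∑ x, Φ i x * g x with hb
  have hE0 : 0 ≤ E := Finset.sum_nonneg fun _ _ => sq_nonneg _
  have hEa : E = ∑ i, a i ^ 2 := by
    simp [hE, ha, ite_pow, Finset.sum_ite_mem]
  have hgg : ∑ x, g x ^ 2 = E := by
    rw [sum_sq_linear_comb v 1 hv, hEa]
    simp
  have hgθ : ∑ x, g x * θ x = E := by
    have h1 : ∑ x, g x * θ x = ∑ i, a i * ∑ x, v i x * θ x := by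
      simp only [hg, Finset.sum_mul, Finset.mul_sum]
      rw [Finset.sum_comm]
      exact Finset.sum_congr rfl fun i _ => Finset.sum_congr rfl fun x _ => by ring
    rw [h1, hE]
    simp [ha, ite_mul, Finset.sum_ite_mem, sq]
  have hbE : ∑ i, b i ^ 2 = E := by
    rw [← hgg]
    simp only [sq]
    exact (hT.parseval g g).symm
  have hb0 : ∀ i, ¬ lam ≤ ξ i → b i = 0 := by
    intro i hi
    have hvi : ∀ i' ∈ R, ∑ x, Φ i x * v i' x = 0 := by
      intro i' hi'
      have h1 := hT.inner_mulVec i (v i')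
      have h2 : ∑ r, D.mulVec (Φ i) r * D.mulVec (v i') r = ξ i' * ∑ x, Φ i x * v i' x := by
        change D.mulVec (Φ i) ⬝ᵥ D.mulVec (v i') = _
        rw [dotProduct_comm, Matrix.dotProduct_mulVec, ← Matrix.mulVec_transpose,
          Matrix.mulVec_mulVec, hev, smul_dotProduct, dotProduct_comm]
        rfl
      have h3 : (ξ i' - ξ i) * ∑ x, Φ i x * v i' x = 0 := by rw [sub_mul, ← h2, h1, sub_self]
      rcases mul_eq_zero.mp h3 with h4 | h4
      · exact absurd (by linarith [hR i' hi'] : lam ≤ ξ i) hi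
      · exact h4
    simp only [hb, hg, Finset.mul_sum]
    rw [Finset.sum_comm]
    refine Finset.sum_eq_zero fun i' _ => ?_
    simp only [ha]
    split_ifs with hi'
    · calc _ = (∑ x, v i' x * θ x) * ∑ x, Φ i x * v i' x := by
            rw [Finset.mul_sum]
            exact Finset.sum_congr rfl fun x _ => by ring
        _ = 0 := by rw [hvi i' hi', mul_zero]
    · simp
  set c : (Fin d → Fin N) → ℝ := fun i => b i / ξ i with hc
  have hξpos : ∀ i, lam ≤ ξ i → 0 < ξ i := fun i hi => lt_of_lt_of_le hlam hi
  have hEq : E = ∑ p, D.mulVec θ p * ∑ i, c i * D.mulVec (Φ i) p := by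
    have hswap : ∑ p, D.mulVec θ p * ∑ i, c i * D.mulVec (Φ i) p =
        ∑ i, c i * ∑ p, D.mulVec (Φ i) p * D.mulVec θ p := by
      simp only [Finset.mul_sum]
      rw [Finset.sum_comm]
      exact Finset.sum_congr rfl fun i _ => Finset.sum_congr rfl fun p _ => by ring
    rw [← hgθ, hT.parseval g θ, hswap]
    refine Finset.sum_congr rfl fun i _ => ?_
    rw [hT.inner_mulVec i θ, ← mul_assoc]
    congr 1
    by_cases hi : lam ≤ ξ i
    · have := hξpos i hi
      simp only [hc]; field_simp; rfl
    · simp only [hc]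
      have := hb0 i hi
      simp only [hb] at this ⊢
      rw [this]; simp
  have hrow : ∀ p, (∑ i, c i * D.mulVec (Φ i) p) ^ 2 ≤ E * B := by
    intro p
    have h1 : ∑ i, c i * D.mulVec (Φ i) p =
        ∑ i with lam ≤ ξ i, b i * (D.mulVec (Φ i) p / ξ i) := by
      rw [Finset.sum_filter]
      refine Finset.sum_congr rfl fun i _ => ?_
      split_ifs with hi
      · simp only [hc]; ring
      · simp only [hc, hb0 i hi]; simp
    rw [h1]
    refine (Finset.sum_mul_sq_le_sq_mul_sq _ _ _).trans ?_
    have h2 : ∑ i with lam ≤ ξ i, b i ^ 2 ≤ E := by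
      rw [← hbE]
      exact Finset.sum_le_sum_of_subset_of_nonneg (Finset.subset_univ _) fun _ _ _ => sq_nonneg _
    have h3 : ∑ i with lam ≤ ξ i, (D.mulVec (Φ i) p / ξ i) ^ 2 ≤ B := by
      refine le_trans (Finset.sum_le_sum fun i hi => ?_) (hB p)
      have := hξpos i (Finset.mem_filter.mp hi).2
      rw [div_pow, div_le_div_iff₀ (by positivity) this]
      have h4 := sq_ktfMat_mulVec_le h p i
      calc _ ≤ (ξ i * ∏ l, rowWeight ρ φ p l (i l)) * ξ i := by gcongr
        _ = _ := by ring
    gcongr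
  have hrow' : ∀ p, |∑ i, c i * D.mulVec (Φ i) p| ≤ √(E * B) := fun p => Real.abs_le_sqrt (hrow p)
  have hE1 : E ≤ Cn * √(E * B) := by
    rw [hEq]
    refine (le_abs_self _).trans ((Finset.abs_sum_le_sum_abs _ _).trans ?_)
    rw [← hEq]
    calc ∑ p, |D.mulVec θ p * ∑ i, c i * D.mulVec (Φ i) p|
        ≤ ∑ p, |D.mulVec θ p| * √(E * B) := by
          refine Finset.sum_le_sum fun p _ => ?_
          rw [abs_mul]
          exact mul_le_mul_of_nonneg_left (hrow' p) (abs_nonneg _)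
      _ ≤ _ := by
          rw [← Finset.sum_mul]
          gcongr
  have hE2 : E ^ 2 ≤ Cn ^ 2 * (E * B) := by
    rw [← Real.sq_sqrt (mul_nonneg hE0 hB0), ← mul_pow]
    exact pow_le_pow_left₀ hE0 hE1 2
  rcases hE0.eq_or_lt with h0 | hpos
  · rw [← h0]; positivity
  · refine le_of_mul_le_mul_right ?_ hpos
    linarith
end

section

variable {ι : Type*} [Fintype ι]

theorem lintegral_sq_gaussSeq (θ : ι → ℝ) (σ : ℝ) (w : ι → ℝ) :
    ∫⁻ y, ENNReal.ofReal ((∑ x, w x * (y x - θ x)) ^ 2) ∂(gaussSeq θ σ) =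
      ENNReal.ofReal (σ ^ 2 * ∑ x, w x ^ 2) := by
  set μ : ι → Measure ℝ := fun i => gaussianReal (θ i) (Real.toNNReal (σ ^ 2)) with hμ
  have hid : ∀ i, MemLp (fun y : ℝ => y) 2 (μ i) := fun i =>
    memLp_id_gaussianReal' 2 (by norm_num)
  have hL : ∀ i, MemLp (fun y : ℝ => w i * (y - θ i)) 2 (μ i) := fun i =>
    ((hid i).sub (memLp_const _)).const_mul _
  have hLpi : ∀ i, MemLp (fun y : ι → ℝ => w i * (y i - θ i)) 2 (Measure.pi μ) := fun i =>
    (hL i).comp_measurePreserving (measurePreserving_eval μ i)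
  have hsum : MemLp (fun y : ι → ℝ => ∑ i, w i * (y i - θ i)) 2 (Measure.pi μ) :=
    memLp_finsetSum _ fun i _ => hLpi i
  have hmean1 : ∀ i, ∫ y, w i * (y - θ i) ∂(μ i) = 0 := by
    intro i
    rw [integral_const_mul, integral_sub ((hid i).integrable (by norm_num)) (integrable_const _)]
    simp [hμ, integral_id_gaussianReal]
  have hmean : ∫ y, ∑ i, w i * (y i - θ i) ∂(Measure.pi μ) = 0 := by
    rw [integral_finsetSum _ fun i _ => (hLpi i).integrable (by norm_num)]
    refine Finset.sum_eq_zero fun i _ => ?_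
    rw [integral_comp_eval (μ := μ) (f := fun y : ℝ => w i * (y - θ i))
      (hL i).aestronglyMeasurable, hmean1]
  have hvar := variance_sum_pi hL
  have hvar1 : ∀ i, Var[fun y : ℝ => w i * (y - θ i); μ i] = σ ^ 2 * w i ^ 2 := by
    intro i
    rw [variance_const_mul, variance_sub_const (hid i).aestronglyMeasurable,
      variance_fun_id_gaussianReal, Real.coe_toNNReal _ (sq_nonneg σ)]
    ring
  have hfun : (∑ i, fun y : ι → ℝ => w i * (y i - θ i)) = fun y => ∑ i, w i * (y i - θ i) := by
    funext y; simp
  rw [hfun, variance_of_integral_eq_zero hsum.aestronglyMeasurable.aemeasurable hmean] at hvar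
  simp only [hvar1, ← Finset.mul_sum] at hvar
  rw [← hvar]
  exact (ofReal_integral_eq_lintegral_ofReal hsum.integrable_sq
    (Filter.Eventually.of_forall fun _ => sq_nonneg _)).symm

variable [DecidableEq ι]

theorem orthonormal_complete (v : ι → ι → ℝ)
    (hv : ∀ i i', ∑ x, v i x * v i' x = if i = i' then (1 : ℝ) else 0) (θ : ι → ℝ) (x : ι) :
    θ x = ∑ i, (∑ y, v i y * θ y) * v i x := by
  have h : IsEigenbasis (0 : Matrix ι ι ℝ) 0 v := ⟨hv, by simp⟩
  exact h.expand θ x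

/-- The loss of a projection estimator splits into its noise and its bias. -/
theorem projection_loss (v : ι → ι → ℝ)
    (hv : ∀ i i', ∑ x, v i x * v i' x = if i = i' then (1 : ℝ) else 0) (Q : Finset ι)
    (y θ : ι → ℝ) :
    ∑ x, ((∑ i ∈ Q, (∑ x', v i x' * y x') * v i x) - θ x) ^ 2 =
      ∑ i ∈ Q, (∑ x, v i x * (y x - θ x)) ^ 2 + ∑ i ∈ Qᶜ, (∑ x, v i x * θ x) ^ 2 := by
  set c : ι → ℝ := fun i => if i ∈ Q then ∑ x, v i x * (y x - θ x) else -∑ x, v i x * θ x with hc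
  have h1 : ∀ x, (∑ i ∈ Q, (∑ x', v i x' * y x') * v i x) - θ x = ∑ i, c i * v i x := by
    intro x
    have hQ : ∑ i ∈ Q, (∑ x', v i x' * y x') * v i x =
        ∑ i, if i ∈ Q then (∑ x', v i x' * y x') * v i x else 0 := by simp
    rw [orthonormal_complete v hv θ x, hQ, ← Finset.sum_sub_distrib]
    refine Finset.sum_congr rfl fun i _ => ?_
    simp only [hc]
    split_ifs
    · simp only [mul_sub, Finset.sum_sub_distrib, sub_mul]
    · ring
  simp only [h1]
  rw [sum_sq_linear_comb v 1 hv, ← Finset.sum_add_sum_compl Q]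
  congr 1
  · exact Finset.sum_congr rfl fun i hi => by simp [hc, hi]
  · exact Finset.sum_congr rfl fun i hi => by simp [hc, Finset.mem_compl.mp hi]

theorem riskE_projection (v : ι → ι → ℝ)
    (hv : ∀ i i', ∑ x, v i x * v i' x = if i = i' then (1 : ℝ) else 0) (Q : Finset ι)
    (θ : ι → ℝ) (σ : ℝ) [Nonempty ι] :
    riskE (fun y x => ∑ i ∈ Q, (∑ x', v i x' * y x') * v i x) θ σ =
      ENNReal.ofReal ((σ ^ 2 * Q.card + ∑ i ∈ Qᶜ, (∑ x, v i x * θ x) ^ 2) / Fintype.card ι) := by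
  have hn : (0 : ℝ) < Fintype.card ι := by exact_mod_cast Fintype.card_pos
  have hb : 0 ≤ ∑ i ∈ Qᶜ, (∑ x, v i x * θ x) ^ 2 := Finset.sum_nonneg fun _ _ => sq_nonneg _
  have hprob : IsProbabilityMeasure (gaussSeq θ σ) := by unfold gaussSeq; infer_instance
  unfold riskE
  simp only [projection_loss v hv Q _ θ]
  have h1 : ∫⁻ y, ENNReal.ofReal (∑ i ∈ Q, (∑ x, v i x * (y x - θ x)) ^ 2 +
      ∑ i ∈ Qᶜ, (∑ x, v i x * θ x) ^ 2) ∂(gaussSeq θ σ) =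
      ENNReal.ofReal (σ ^ 2 * Q.card + ∑ i ∈ Qᶜ, (∑ x, v i x * θ x) ^ 2) := by
    simp only [ENNReal.ofReal_add (Finset.sum_nonneg fun _ _ => sq_nonneg _) hb,
      ENNReal.ofReal_sum_of_nonneg fun _ _ => sq_nonneg _]
    rw [lintegral_add_right _ measurable_const, lintegral_const, measure_univ, mul_one,
      lintegral_finsetSum _ fun i _ => by fun_prop, ENNReal.ofReal_add (by positivity) hb]
    simp only [lintegral_sq_gaussSeq]
    have h2 : ∀ i, ∑ x, v i x ^ 2 = 1 := fun i => by simpa [sq] using hv i i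
    simp only [h2, mul_one, Finset.sum_const, nsmul_eq_mul]
    rw [mul_comm, ENNReal.ofReal_mul (sq_nonneg σ), ENNReal.ofReal_natCast,
      ENNReal.ofReal_sum_of_nonneg fun _ _ => sq_nonneg _]
  rw [h1, div_eq_inv_mul, ENNReal.ofReal_mul (by positivity), ENNReal.ofReal_inv_of_pos hn,
    ENNReal.ofReal_natCast]

end

section

theorem vecMul_Dop_injective (N m : ℕ) :
    Function.Injective fun g : Fin (N - m) → ℝ => g ᵥ* Dop N m := by
  intro g g' hgg
  have h0 : (Dop N m)ᵀ.mulVec (g - g') = 0 := by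
    rw [Matrix.mulVec_transpose, Matrix.sub_vecMul]
    exact sub_eq_zero.mpr hgg
  have h1 := sum_sq_le_Dop_transpose N m (g - g')
  rw [h0] at h1
  have h2 : ∑ i, ((g - g') i) ^ 2 = 0 :=
    le_antisymm (by simpa using h1) (Finset.sum_nonneg fun _ _ => sq_nonneg _)
  funext i
  have := (Finset.sum_eq_zero_iff_of_nonneg fun _ _ => sq_nonneg _).mp h2 i (Finset.mem_univ i)
  exact sub_eq_zero.mp (pow_eq_zero_iff two_ne_zero |>.mp this)

theorem card_eigenvalues_ne_zero {N m : ℕ} (hH : ((Dop N m)ᵀ * Dop N m).IsHermitian) :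
    Fintype.card {i // hH.eigenvalues i ≠ 0} = N - m := by
  rw [← hH.rank_eq_card_non_zero_eigs, Matrix.rank_transpose_mul_self,
    (Matrix.vecMul_injective_iff.mp (vecMul_Dop_injective N m)).rank_matrix, Fintype.card_fin]

theorem exists_isEigenbasis {N m : ℕ} (hH : ((Dop N m)ᵀ * Dop N m).IsHermitian) (ρ : Fin N → ℝ)
    (σp : Equiv.Perm (Fin N)) (hρ : ∀ i, ρ i = hH.eigenvalues (σp i)) :
    ∃ φ : Fin N → Fin N → ℝ, IsEigenbasis (Dop N m) ρ φ := by
  refine ⟨fun a => hH.eigenvectorBasis (σp a), IsEigenbasis.of_eigenvectors (fun a b => ?_)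
    fun a => ?_⟩
  · have := (orthonormal_iff_ite.mp hH.eigenvectorBasis.orthonormal) (σp b) (σp a)
    simpa [PiLp.inner_apply, eq_comm] using this
  · rw [hH.mulVec_eigenvectorBasis, hρ]

theorem eigenvalue_pos {N m : ℕ} (hH : ((Dop N m)ᵀ * Dop N m).IsHermitian) (ρ : Fin N → ℝ)
    (hmono : Monotone ρ) (hnonneg : ∀ a, 0 ≤ ρ a)
    (σp : Equiv.Perm (Fin N)) (hρ : ∀ i, ρ i = hH.eigenvalues (σp i))
    (a : Fin N) (ha : m ≤ a) : 0 < ρ a := by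
  refine lt_of_le_of_ne (hnonneg a) fun h0 => ?_
  have hcard : Fintype.card {i // ρ i ≠ 0} = N - m := by
    rw [← card_eigenvalues_ne_zero hH]
    exact Fintype.card_congr (σp.subtypeEquiv fun i => by rw [hρ])
  have hsub : (Finset.univ.filter fun i => ρ i ≠ 0) ⊆ Finset.Ioi a := by
    intro i hi
    rw [Finset.mem_Ioi]
    by_contra hia
    exact (Finset.mem_filter.mp hi).2
      (le_antisymm ((hmono (not_lt.mp hia)).trans h0.symm.le) (hnonneg i))
  have := Finset.card_le_card hsub
  rw [← Fintype.card_subtype, hcard, Fin.card_Ioi] at this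
  have := a.2
  omega

theorem alpha_pow {k : ℕ} {t : ℝ} (ht : 0 ≤ t) :
    (t ^ (1 / (2 * ((k : ℝ) + 1)))) ^ (2 * (k + 1)) = t := by
  rw [← Real.rpow_natCast, ← Real.rpow_mul ht]
  have : 1 / (2 * ((k : ℝ) + 1)) * ((2 * (k + 1) : ℕ) : ℝ) = 1 := by push_cast; field_simp
  rw [this, Real.rpow_one]

variable {N d k : ℕ} {ρ : Fin N → ℝ} {φ : Fin N → Fin N → ℝ}

/-- Every positive eigenvalue of `DᵀD` is at least `N^{-2(k+1)}`. -/
theorem inv_le_eigenvalue_rpow (h : IsEigenbasis (Dop N (k + 1)) ρ φ) (a : Fin N)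
    (ha : 0 < ρ a) : 1 / (N : ℝ) ≤ (ρ a) ^ (1 / (2 * ((k : ℝ) + 1))) := by
  have hN : (0 : ℝ) < N := by exact_mod_cast a.pos
  have h1 := sum_sq_le_Dop_transpose N (k + 1) ((Dop N (k + 1)).mulVec (φ a))
  rw [h.eigen] at h1
  have h2 : ∑ r, ((Dop N (k + 1)).mulVec (φ a) r) ^ 2 = ρ a := by
    simpa [sq] using h.gram a a
  have h3 : ∑ x, ((ρ a • φ a) x) ^ 2 = ρ a ^ 2 := by
    have : ∑ x, φ a x ^ 2 = 1 := by simpa [sq] using h.orth a a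
    simp only [Pi.smul_apply, smul_eq_mul, mul_pow, ← Finset.mul_sum, this, mul_one]
  rw [h2, h3] at h1
  have h4 : 1 ≤ (N : ℝ) ^ (2 * (k + 1)) * ρ a := by
    refine le_of_mul_le_mul_right ?_ ha
    linarith
  refine le_of_pow_le_pow_left₀ (n := 2 * (k + 1)) (by omega) (Real.rpow_nonneg ha.le _) ?_
  rw [alpha_pow ha.le, div_pow, one_pow, div_le_iff₀ (by positivity)]
  linarith

/-- Counting bound for the eigenvalues of `DᵀD`. -/
theorem le_rpow_of_count (h : IsEigenbasis (Dop N (k + 1)) ρ φ) (hmono : Monotone ρ)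
    (a : Fin N) (ha : 2 * weylConst k ≤ a) :
    (a : ℝ) ≤ 2 * weylConst k * N * (ρ a) ^ (1 / (2 * ((k : ℝ) + 1))) := by
  have hN : (0 : ℝ) < N := by exact_mod_cast a.pos
  have h1 : ((a : ℕ) : ℝ) ≤ ∑ b with ρ b ≤ ρ a, (1 : ℝ) := by
    have hsub : Finset.Iic a ⊆ Finset.univ.filter fun b => ρ b ≤ ρ a := fun b hb =>
      Finset.mem_filter.mpr ⟨Finset.mem_univ _, hmono (Finset.mem_Iic.mp hb)⟩
    have := Finset.card_le_card hsub
    rw [Fin.card_Iic] at this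
    simp only [Finset.sum_const, nsmul_eq_mul, mul_one]
    exact_mod_cast (Nat.le_succ _).trans this
  have h2 : ∑ b with ρ b ≤ ρ a, (1 : ℝ) = ∑ x, ∑ b with ρ b ≤ ρ a, φ b x ^ 2 := by
    rw [Finset.sum_comm]
    exact Finset.sum_congr rfl fun b _ => by simpa [sq] using (h.orth b b).symm
  have h3 := Finset.sum_le_sum fun x (_ : x ∈ Finset.univ) =>
    local_weyl_right h (ρ a) (h.nonneg a) x
  rw [Finset.sum_const, Finset.card_univ, Fintype.card_fin, nsmul_eq_mul] at h3
  have h4 : (N : ℝ) * (weylConst k * ((ρ a) ^ (1 / (2 * ((k : ℝ) + 1))) + 1 / N)) =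
      weylConst k * N * (ρ a) ^ (1 / (2 * ((k : ℝ) + 1))) + weylConst k := by
    field_simp
  linarith [h1.trans (h2.trans_le h3)]

theorem mass_le (h : IsEigenbasis (Dop N (k + 1)) ρ φ) (c lam : ℝ)
    (hlam : 0 < lam) (hN : 1 / (N : ℝ) ≤ c * lam ^ (1 / (2 * ((k : ℝ) + 1)))) (hc : 0 ≤ c)
    (p : KtfIdx N d (k + 1)) (t : ℝ) (ht : lam ≤ t) :
    ∑ i : Fin d → Fin N with ∑ j, ρ (i j) ≤ t, ∏ l, rowWeight ρ φ p l (i l) ≤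
      (weylConst k * (1 + c)) ^ d * t ^ ((d : ℝ) / (2 * ((k : ℝ) + 1))) := by
  have ht0 : 0 ≤ t := hlam.le.trans ht
  have hW := weylConst_pos k
  have hK : ∀ l, ∑ a with ρ a ≤ t, rowWeight ρ φ p l a ≤
      weylConst k * (1 + c) * t ^ (1 / (2 * ((k : ℝ) + 1))) := by
    intro l
    refine (sum_rowWeight_le h p l t ht0).trans ?_
    have h1 : c * lam ^ (1 / (2 * ((k : ℝ) + 1))) ≤ c * t ^ (1 / (2 * ((k : ℝ) + 1))) := by
      gcongr
    rw [mul_assoc]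
    gcongr
    linarith
  refine (sum_prod_le_of_local_weyl ρ h.nonneg _ (rowWeight_nonneg h p) t _ hK).trans_eq ?_
  rw [mul_pow, ← Real.rpow_natCast (t ^ _) d, ← Real.rpow_mul ht0]
  congr 2
  ring

theorem sum_prod_rowWeight_le_one (h : IsEigenbasis (Dop N (k + 1)) ρ φ)
    (p : KtfIdx N d (k + 1)) : ∑ i : Fin d → Fin N, ∏ l, rowWeight ρ φ p l (i l) ≤ 1 := by
  rw [sum_prod_pi (fun l => rowWeight ρ φ p l)]
  exact Finset.prod_le_one (fun l _ => Finset.sum_nonneg fun a _ => rowWeight_nonneg h p l a)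
    fun l _ => sum_rowWeight_le_one h p l

theorem card_box_le (N d τ : ℕ) :
    (Finset.univ.filter (fun i : Fin d → Fin N => ∀ j, (i j : ℕ) < τ)).card ≤ τ ^ d := by
  have h1 : (Finset.univ.filter (fun i : Fin d → Fin N => ∀ j, (i j : ℕ) < τ)) =
      Fintype.piFinset fun _ : Fin d => Finset.univ.filter fun a : Fin N => (a : ℕ) < τ := by
    ext i
    simp
  rw [h1, Fintype.card_piFinset_const]
  gcongr
  calc (Finset.univ.filter fun a : Fin N => (a : ℕ) < τ).card
      ≤ (Finset.range τ).card := Finset.card_le_card_of_injOn (fun a => (a : ℕ))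
        (fun a ha => by simpa using ha) (fun a _ b _ hab => Fin.ext hab)
    _ = τ := Finset.card_range τ

/-- Outside of the box of indices below `a`, the eigenvalues are at least `ρ a`. -/
theorem le_sum_of_mem_compl_box (hρ : ∀ a, 0 ≤ ρ a) (hmono : Monotone ρ) (a : Fin N)
    (i : Fin d → Fin N)
    (hi : i ∈ (Finset.univ.filter (fun i : Fin d → Fin N => ∀ j, (i j : ℕ) < a))ᶜ) :
    ρ a ≤ ∑ j, ρ (i j) := by
  simp only [Finset.mem_compl, Finset.mem_filter, Finset.mem_univ, true_and, not_forall,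
    not_lt] at hi
  obtain ⟨j, hj⟩ := hi
  exact (hmono (Fin.le_def.mpr hj)).trans
    (Finset.single_le_sum (f := fun j => ρ (i j)) (fun _ _ => hρ _) (Finset.mem_univ j))

/-- The constant in the bias bound for `d > 2(k+1)`. -/
def roughConst (k d : ℕ) : ℝ :=
  1 + 2 * (weylConst k * (1 + 1)) ^ d *
    (1 - (2 : ℝ) ^ (1 - (d : ℝ) / (2 * ((k : ℝ) + 1))))⁻¹

theorem roughConst_pos {k d : ℕ} (hkd : 2 * (k + 1) < d) : 0 < roughConst k d := by
  have h1 : 1 < (d : ℝ) / (2 * ((k : ℝ) + 1)) := by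
    rw [one_lt_div (by positivity)]
    exact_mod_cast hkd
  have h2 : (2 : ℝ) ^ (1 - (d : ℝ) / (2 * ((k : ℝ) + 1))) < 1 :=
    Real.rpow_lt_one_of_one_lt_of_neg (by norm_num) (by linarith)
  have h3 : 0 < 1 - (2 : ℝ) ^ (1 - (d : ℝ) / (2 * ((k : ℝ) + 1))) := by linarith
  have := weylConst_pos k
  unfold roughConst
  positivity

theorem sum_div_le_roughConst (h : IsEigenbasis (Dop N (k + 1)) ρ φ) (hkd : 2 * (k + 1) < d)
    (a : Fin N) (ha : 0 < ρ a) (p : KtfIdx N d (k + 1)) :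
    ∑ i : Fin d → Fin N with ρ a ≤ ∑ j, ρ (i j),
      (∏ l, rowWeight ρ φ p l (i l)) / (∑ j, ρ (i j)) ≤ roughConst k d := by
  have h1 : 1 < (d : ℝ) / (2 * ((k : ℝ) + 1)) := by
    rw [one_lt_div (by positivity)]
    exact_mod_cast hkd
  have := weylConst_pos k
  exact sum_div_le_of_one_lt_mass (fun i : Fin d → Fin N => ∏ l, rowWeight ρ φ p l (i l))
    (fun i => ∑ j, ρ (i j)) (fun i => Finset.prod_nonneg fun l _ => rowWeight_nonneg h p l _)
    (ρ a) _ _ ha (by positivity) h1 (sum_prod_rowWeight_le_one h p)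
    (mass_le h 1 (ρ a) ha (by rw [one_mul]; exact inv_le_eigenvalue_rpow h a ha) zero_le_one p)

/-- The constant in the bias bound for `d < 2(k+1)`. -/
def smoothConst (k d : ℕ) : ℝ :=
  2 * (weylConst k * (1 + 2 * weylConst k)) ^ d *
    (1 - (2 : ℝ) ^ ((d : ℝ) / (2 * ((k : ℝ) + 1)) - 1))⁻¹ *
    (2 * weylConst k) ^ (2 * (k + 1) - d)

theorem smoothConst_pos {k d : ℕ} (hkd : d < 2 * (k + 1)) : 0 < smoothConst k d := by
  have h1 : (d : ℝ) / (2 * ((k : ℝ) + 1)) < 1 := by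
    rw [div_lt_one (by positivity)]
    exact_mod_cast hkd
  have h2 : (2 : ℝ) ^ ((d : ℝ) / (2 * ((k : ℝ) + 1)) - 1) < 1 :=
    Real.rpow_lt_one_of_one_lt_of_neg (by norm_num) (by linarith)
  have h3 : 0 < 1 - (2 : ℝ) ^ ((d : ℝ) / (2 * ((k : ℝ) + 1)) - 1) := by linarith
  have := weylConst_pos k
  unfold smoothConst
  positivity

theorem sum_div_le_smoothConst (h : IsEigenbasis (Dop N (k + 1)) ρ φ) (hmono : Monotone ρ)
    (hkd : d < 2 * (k + 1)) (a : Fin N) (ha : 0 < ρ a) (ha1 : 1 ≤ (a : ℕ))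
    (haW : 2 * weylConst k ≤ a) (p : KtfIdx N d (k + 1)) :
    ∑ i : Fin d → Fin N with ρ a ≤ ∑ j, ρ (i j),
      (∏ l, rowWeight ρ φ p l (i l)) / (∑ j, ρ (i j)) ≤
      smoothConst k d * ((N : ℝ) / a) ^ (2 * (k + 1) - d) := by
  have h1 : (d : ℝ) / (2 * ((k : ℝ) + 1)) < 1 := by
    rw [div_lt_one (by positivity)]
    exact_mod_cast hkd
  have h2 : (2 : ℝ) ^ ((d : ℝ) / (2 * ((k : ℝ) + 1)) - 1) < 1 :=
    Real.rpow_lt_one_of_one_lt_of_neg (by norm_num) (by linarith)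
  have h3 : 0 < 1 - (2 : ℝ) ^ ((d : ℝ) / (2 * ((k : ℝ) + 1)) - 1) := by linarith
  have hW := weylConst_pos k
  have hN : (0 : ℝ) < N := by exact_mod_cast a.pos
  have ha1' : (1 : ℝ) ≤ (a : ℕ) := by exact_mod_cast ha1
  have hcount := le_rpow_of_count h hmono a haW
  set u := (ρ a) ^ (1 / (2 * ((k : ℝ) + 1))) with hu
  have hu0 : 0 < u := Real.rpow_pos_of_pos ha _
  have hNu : 1 / (N : ℝ) ≤ 2 * weylConst k * u := by
    rw [div_le_iff₀ hN]
    linarith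
  refine (sum_div_le_of_mass_lt_one (fun i : Fin d → Fin N => ∏ l, rowWeight ρ φ p l (i l))
    (fun i => ∑ j, ρ (i j)) (fun i => Finset.prod_nonneg fun l _ => rowWeight_nonneg h p l _)
    (ρ a) _ _ ha (by positivity) h1
    (mass_le h (2 * weylConst k) (ρ a) ha hNu (by positivity) p)).trans ?_
  have hpow : (ρ a) ^ ((d : ℝ) / (2 * ((k : ℝ) + 1)) - 1) = (u⁻¹) ^ (2 * (k + 1) - d) := by
    rw [hu, ← Real.rpow_neg ha.le, ← Real.rpow_natCast, ← Real.rpow_mul ha.le,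
      Nat.cast_sub hkd.le]
    congr 1
    push_cast
    field_simp
    ring
  rw [hpow, smoothConst, mul_assoc _ (_ ^ (2 * (k + 1) - d)), ← mul_pow]
  gcongr
  rw [mul_div_assoc', le_div_iff₀ (by linarith), inv_mul_le_iff₀ hu0]
  linarith

end

/-- The critical cut-off index `(C_n² N^{2(k+1)-d})^{1/(2(k+1))}`. -/
def cutoff (k d N : ℕ) (Cn : ℝ) : ℝ :=
  (Cn ^ 2 * (N : ℝ) ^ (2 * (k + 1) - d)) ^ (1 / (2 * ((k : ℝ) + 1)))

section

variable {k d N : ℕ} {Cn : ℝ}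

theorem cutoff_pos (hN : 0 < N) (hCn : 0 < Cn) : 0 < cutoff k d N Cn := by
  unfold cutoff
  have : (0 : ℝ) < N := by exact_mod_cast hN
  positivity

theorem cutoff_pow (hCn : 0 < Cn) :
    (cutoff k d N Cn) ^ (2 * (k + 1)) = Cn ^ 2 * (N : ℝ) ^ (2 * (k + 1) - d) :=
  alpha_pow (by positivity)

theorem cutoff_le (hkd : d < 2 * (k + 1)) (hN : 0 < N) (hCn : 0 < Cn)
    (hCn' : Cn ≤ √((N ^ d : ℕ) : ℝ)) : cutoff k d N Cn ≤ N := by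
  refine le_of_pow_le_pow_left₀ (n := 2 * (k + 1)) (by omega) (by positivity) ?_
  rw [cutoff_pow hCn]
  have h1 : Cn ^ 2 ≤ (N : ℝ) ^ d := by
    have := (Real.le_sqrt hCn.le (by positivity)).mp hCn'
    exact_mod_cast this
  calc Cn ^ 2 * (N : ℝ) ^ (2 * (k + 1) - d) ≤ (N : ℝ) ^ d * (N : ℝ) ^ (2 * (k + 1) - d) := by
        gcongr
    _ = _ := by rw [← pow_add, Nat.add_sub_cancel' hkd.le]

theorem cutoff_pow_div (hkd : d < 2 * (k + 1)) (hd : 1 ≤ d) (hN : 0 < N) (hCn : 0 < Cn) :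
    (cutoff k d N Cn) ^ d / ((N ^ d : ℕ) : ℝ) =
      (Cn ^ 2 / ((N ^ d : ℕ) : ℝ)) ^ ((1 : ℝ) / (2 * (((k : ℝ) + 1) / d))) := by
  have hN' : (0 : ℝ) < N := by exact_mod_cast hN
  have hd' : (0 : ℝ) < d := by exact_mod_cast hd
  have hT := (cutoff_pos (k := k) (d := d) hN hCn).le
  have h1 : Cn ^ 2 / ((N ^ d : ℕ) : ℝ) = (cutoff k d N Cn / N) ^ (2 * (k + 1)) := by
    rw [div_pow, cutoff_pow hCn, div_eq_div_iff (by positivity) (by positivity)]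
    push_cast
    rw [mul_assoc, ← pow_add, Nat.sub_add_cancel hkd.le]
  rw [h1, ← Real.rpow_natCast (_ / _), ← Real.rpow_mul (by positivity)]
  have h2 : (((2 * (k + 1) : ℕ) : ℝ)) * (1 / (2 * (((k : ℝ) + 1) / d))) = d := by
    push_cast; field_simp
  rw [h2, Real.rpow_natCast, div_pow]
  push_cast
  rfl

theorem cutoff_pow_eq (hkd : d < 2 * (k + 1)) (hd : 1 ≤ d) (hN : 0 < N) (hCn : 0 < Cn) :
    (Cn * ((N ^ d : ℕ) : ℝ) ^ ((((k : ℝ) + 1) / d) - 1 / 2)) ^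
      ((1 : ℝ) / (((k : ℝ) + 1) / d)) = (cutoff k d N Cn) ^ d := by
  have hN' : (0 : ℝ) < N := by exact_mod_cast hN
  have hd' : (0 : ℝ) < d := by exact_mod_cast hd
  have hT := (cutoff_pos (k := k) (d := d) hN hCn).le
  have h1 : Cn * ((N ^ d : ℕ) : ℝ) ^ ((((k : ℝ) + 1) / d) - 1 / 2) =
      (cutoff k d N Cn) ^ (k + 1) := by
    refine (pow_left_inj₀ (by positivity) (by positivity) two_ne_zero).mp ?_
    rw [← pow_mul, mul_comm (k + 1) 2, cutoff_pow hCn, mul_pow]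
    congr 1
    rw [← Real.rpow_natCast _ 2, ← Real.rpow_mul (by positivity), Nat.cast_pow,
      ← Real.rpow_natCast _ d, ← Real.rpow_mul hN'.le, ← Real.rpow_natCast, Nat.cast_sub hkd.le]
    congr 1
    push_cast
    field_simp
  rw [h1, ← Real.rpow_natCast, ← Real.rpow_mul hT, ← Real.rpow_natCast]
  congr 1
  push_cast
  field_simp

end

/-- The smallest cut-off for which the eigenvalue counting bound is effective. -/
def minCut (k : ℕ) : ℕ := k + 2 + ⌈2 * weylConst k⌉₊

variable {N d k : ℕ} {ρ : Fin N → ℝ}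

theorem rough_risk_le (hkd : 2 * (k + 1) < d) (hN : k + 1 < N) (σ Cn : ℝ)
    (hH : ((Dop N (k + 1))ᵀ * Dop N (k + 1)).IsHermitian) (hmono : Monotone ρ)
    (σp : Equiv.Perm (Fin N)) (hσp : ∀ i, ρ i = hH.eigenvalues (σp i))
    (v : (Fin d → Fin N) → (Fin d → Fin N) → ℝ)
    (hv : ∀ i i', ∑ x, v i x * v i' x = if i = i' then (1 : ℝ) else 0)
    (hev : ∀ i, ((ktfMat N d (k + 1))ᵀ * ktfMat N d (k + 1)).mulVec (v i) =
          (∑ j, ρ (i j)) • v i)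
    (θ : (Fin d → Fin N) → ℝ) (hθ : ∑ p, |(ktfMat N d (k + 1)).mulVec θ p| ≤ Cn) :
    riskE (fun y x =>
        ∑ i ∈ Finset.univ.filter (fun i : Fin d → Fin N => ∀ j, (i j : ℕ) ≤ k),
          (∑ x', v i x' * y x') * v i x) θ σ ≤
      ENNReal.ofReal ((σ ^ 2 * (k + 1) ^ d + Cn ^ 2 * roughConst k d) / ((N ^ d : ℕ) : ℝ)) := by
  obtain ⟨φ, h⟩ := exists_isEigenbasis hH ρ σp hσp
  set a : Fin N := ⟨k + 1, hN⟩ with ha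
  have hpos : 0 < ρ a := eigenvalue_pos hH ρ hmono h.nonneg σp hσp a le_rfl
  have : Nonempty (Fin d → Fin N) := ⟨fun _ => a⟩
  simp only [← Nat.lt_succ_iff]
  rw [riskE_projection v hv]
  have hcard : Fintype.card (Fin d → Fin N) = N ^ d := by simp
  rw [hcard]
  refine ENNReal.ofReal_le_ofReal ?_
  gcongr
  · exact_mod_cast card_box_le N d (k + 1)
  · exact bias_le h v hv hev _ (ρ a) hpos
      (fun i hi => le_sum_of_mem_compl_box h.nonneg hmono a i hi) _ (roughConst_pos hkd).le
      (sum_div_le_roughConst h hkd a hpos) Cn θ hθ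

theorem smooth_risk_le (hkd : d < 2 * (k + 1)) (hN : k + 1 < N) (σ Cn : ℝ) (hCn : 0 < Cn)
    (hH : ((Dop N (k + 1))ᵀ * Dop N (k + 1)).IsHermitian) (hmono : Monotone ρ)
    (σp : Equiv.Perm (Fin N)) (hσp : ∀ i, ρ i = hH.eigenvalues (σp i))
    (v : (Fin d → Fin N) → (Fin d → Fin N) → ℝ)
    (hv : ∀ i i', ∑ x, v i x * v i' x = if i = i' then (1 : ℝ) else 0)
    (hev : ∀ i, ((ktfMat N d (k + 1))ᵀ * ktfMat N d (k + 1)).mulVec (v i) =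
          (∑ j, ρ (i j)) • v i)
    (θ : (Fin d → Fin N) → ℝ) (hθ : ∑ p, |(ktfMat N d (k + 1)).mulVec θ p| ≤ Cn)
    (τ : ℕ) (hτN : τ ≤ N) (hτ : τ < N → minCut k ≤ τ ∧ cutoff k d N Cn ≤ τ) :
    riskE (fun y x =>
        ∑ i ∈ Finset.univ.filter (fun i : Fin d → Fin N => ∀ j, (i j : ℕ) < τ),
          (∑ x', v i x' * y x') * v i x) θ σ ≤
      ENNReal.ofReal ((σ ^ 2 * τ ^ d + smoothConst k d * cutoff k d N Cn ^ d) /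
        ((N ^ d : ℕ) : ℝ)) := by
  obtain ⟨φ, h⟩ := exists_isEigenbasis hH ρ σp hσp
  have hN0 : 0 < N := by omega
  have : Nonempty (Fin d → Fin N) := ⟨fun _ => ⟨0, hN0⟩⟩
  have hT := cutoff_pos (k := k) (d := d) hN0 hCn
  have hS := smoothConst_pos hkd
  rw [riskE_projection v hv]
  have hcard : Fintype.card (Fin d → Fin N) = N ^ d := by simp
  rw [hcard]
  refine ENNReal.ofReal_le_ofReal ?_
  gcongr
  · exact_mod_cast card_box_le N d τ
  · rcases hτN.eq_or_lt with rfl | hlt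
    · have : (Finset.univ.filter (fun i : Fin d → Fin τ => ∀ j, (i j : ℕ) < τ)) =
          Finset.univ := by simp
      rw [this, Finset.compl_univ, Finset.sum_empty]
      positivity
    obtain ⟨hmin, hcut⟩ := hτ hlt
    unfold minCut at hmin
    have hτW : 2 * weylConst k ≤ τ :=
      (Nat.le_ceil _).trans (by exact_mod_cast (by omega : ⌈2 * weylConst k⌉₊ ≤ τ))
    set a : Fin N := ⟨τ, hlt⟩ with ha
    have hpos : 0 < ρ a := eigenvalue_pos hH ρ hmono h.nonneg σp hσp a (by simp [ha]; omega)
    refine (bias_le h v hv hev _ (ρ a) hpos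
      (fun i hi => le_sum_of_mem_compl_box h.nonneg hmono a i hi) _ (by positivity)
      (sum_div_le_smoothConst h hmono hkd a hpos (by simp [ha]; omega) hτW) Cn θ hθ).trans ?_
    have hτ0 : (0 : ℝ) < τ := hT.trans_le hcut
    set T := cutoff k d N Cn with hTdef
    have hTp : T ^ (2 * (k + 1)) = Cn ^ 2 * (N : ℝ) ^ (2 * (k + 1) - d) := cutoff_pow hCn
    calc Cn ^ 2 * (smoothConst k d * ((N : ℝ) / ((a : ℕ) : ℝ)) ^ (2 * (k + 1) - d))
        ≤ Cn ^ 2 * (smoothConst k d * ((N : ℝ) / T) ^ (2 * (k + 1) - d)) := by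
          gcongr
      _ = smoothConst k d * (T ^ (2 * (k + 1)) / T ^ (2 * (k + 1) - d)) := by
          rw [hTp, div_pow]; ring
      _ = smoothConst k d * T ^ d := by
          congr 1
          rw [div_eq_iff (by positivity), ← pow_add, Nat.add_sub_cancel' hkd.le]

/-- Theorem 5, upper bounds: risk of projection estimators over KTV
classes.  Let `{v_i}_{i ∈ {1,…,N}^d}` be an orthonormal eigenbasis of
`(D_{n,d}^{(k+1)})ᵀ D_{n,d}^{(k+1)}` with eigenvalues `ξ_i = ρ_{i_1} + ⋯ + ρ_{i_d}`
(`ρ` the increasingly ordered eigenvalues of `(D_N^{(k+1)})ᵀ D_N^{(k+1)}`), and let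
`S_Q` denote projection onto `span{v_i : i ∈ Q}`.  With `s = (k+1)/d`, there is
`C > 0` depending only on `k, d, σ` such that over `𝒯_{n,d}^k(C_n)` with
`0 < C_n ≤ √n`: (i) if `s < 1/2`, the polynomial projection estimator
(`Q = {1,…,k+1}^d`) has worst-case risk at most `C(1/n + C_n²/n)`; (ii) if `s > 1/2`,
there is `τ ∈ {k+2,…,N}` with `τ^d ≤ C·max{1, (C_n n^{s-1/2})^{1/s}}` such that the
projection estimator with `Q = {1,…,τ}^d` has worst-case risk at most
`C(1/n + (C_n²/n)^{1/(2s)})`. -/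
theorem ktv_projection_estimator_upper_bound (k d : ℕ) (hd : 1 ≤ d)
    (σ : ℝ) (hσ : 0 < σ) :
    ∃ C : ℝ, 0 < C ∧
      ∀ N : ℕ, k + 1 < N →
      ∀ Cn : ℝ, 0 < Cn → Cn ≤ Real.sqrt ((N ^ d : ℕ) : ℝ) →
      ∀ (hH : ((Dop N (k + 1))ᵀ * Dop N (k + 1)).IsHermitian) (ρ : Fin N → ℝ),
        Monotone ρ →
        (∃ σp : Equiv.Perm (Fin N), ∀ i, ρ i = hH.eigenvalues (σp i)) →
      ∀ v : (Fin d → Fin N) → (Fin d → Fin N) → ℝ,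
        (∀ i i', ∑ x, v i x * v i' x = if i = i' then (1 : ℝ) else 0) →
        (∀ i, ((ktfMat N d (k + 1))ᵀ * ktfMat N d (k + 1)).mulVec (v i) =
          (∑ j, ρ (i j)) • v i) →
        ((2 * (k + 1) < d →
          ∀ θ0 : (Fin d → Fin N) → ℝ,
            ∑ p, |(ktfMat N d (k + 1)).mulVec θ0 p| ≤ Cn →
            riskE (fun y x =>
                ∑ i ∈ Finset.univ.filter (fun i : Fin d → Fin N => ∀ j, (i j : ℕ) ≤ k),
                  (∑ x', v i x' * y x') * v i x) θ0 σ ≤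
              ENNReal.ofReal (C * (1 / ((N ^ d : ℕ) : ℝ) + Cn ^ 2 / ((N ^ d : ℕ) : ℝ)))) ∧
        (d < 2 * (k + 1) →
          ∃ τ : ℕ, k + 2 ≤ τ ∧ τ ≤ N ∧
            ((τ ^ d : ℕ) : ℝ) ≤
              C * max 1 ((Cn * ((N ^ d : ℕ) : ℝ) ^ ((((k : ℝ) + 1) / d) - 1 / 2)) ^
                ((1 : ℝ) / (((k : ℝ) + 1) / d))) ∧
            ∀ θ0 : (Fin d → Fin N) → ℝ,
              ∑ p, |(ktfMat N d (k + 1)).mulVec θ0 p| ≤ Cn →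
              riskE (fun y x =>
                  ∑ i ∈ Finset.univ.filter (fun i : Fin d → Fin N => ∀ j, (i j : ℕ) < τ),
                    (∑ x', v i x' * y x') * v i x) θ0 σ ≤
                ENNReal.ofReal (C * (1 / ((N ^ d : ℕ) : ℝ) +
                  (Cn ^ 2 / ((N ^ d : ℕ) : ℝ)) ^
                    ((1 : ℝ) / (2 * (((k : ℝ) + 1) / d))))))) := by
  set K : ℕ := minCut k with hK
  set A : ℝ := σ ^ 2 * (k + 1) ^ d + (if 2 * (k + 1) < d then roughConst k d else 0) with hA
  set M : ℝ := (2 * (K : ℝ)) ^ d with hM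
  set B : ℝ := σ ^ 2 * M + (if d < 2 * (k + 1) then smoothConst k d else 0) with hB
  have hK2 : k + 2 ≤ K := Nat.le_add_right _ _
  have hK2' : (2 : ℝ) ≤ K := by exact_mod_cast (by omega : 2 ≤ K)
  have hMpos : 0 < M := by positivity
  have hrough : 0 ≤ if 2 * (k + 1) < d then roughConst k d else 0 := by
    split_ifs with h
    exacts [(roughConst_pos h).le, le_rfl]
  have hsmooth : 0 ≤ if d < 2 * (k + 1) then smoothConst k d else 0 := by
    split_ifs with h
    exacts [(smoothConst_pos h).le, le_rfl]
  have hApos : 0 < A := by positivity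
  have hBpos : 0 < B := by positivity
  refine ⟨A + M + B, by positivity, ?_⟩
  intro N hN Cn hCn hCn' hH ρ hmono ⟨σp, hσp⟩ v hv hev
  have hN0 : 0 < N := by omega
  have hn : (0 : ℝ) < ((N ^ d : ℕ) : ℝ) := by positivity
  refine ⟨fun hkd θ hθ => ?_, fun hkd => ?_⟩
  · refine (rough_risk_le hkd hN σ Cn hH hmono σp hσp v hv hev θ hθ).trans
      (ENNReal.ofReal_le_ofReal ?_)
    rw [← add_div, mul_div_assoc']
    gcongr
    have h1 : σ ^ 2 * (k + 1) ^ d + Cn ^ 2 * roughConst k d ≤ A * (1 + Cn ^ 2) := by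
      have hr := roughConst_pos hkd
      rw [hA, if_pos hkd]
      have h2 : 0 ≤ σ ^ 2 * ((k : ℝ) + 1) ^ d * Cn ^ 2 := by positivity
      linarith
    refine h1.trans ?_
    gcongr
    linarith
  · set T := cutoff k d N Cn with hT
    have hTpos : 0 < T := cutoff_pos hN0 hCn
    have hTN : T ≤ N := cutoff_le hkd hN0 hCn hCn'
    set τ := min N (max K ⌈T⌉₊) with hτ
    have hτN : τ ≤ N := min_le_left _ _
    have hτK : (τ : ℝ) ≤ 2 * K * max 1 T := by
      have h1 : (τ : ℝ) ≤ max (K : ℝ) (⌈T⌉₊ : ℝ) := by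
        exact_mod_cast min_le_right N (max K ⌈T⌉₊)
      have h2 : (⌈T⌉₊ : ℝ) < T + 1 := Nat.ceil_lt_add_one hTpos.le
      have h3 : (1 : ℝ) ≤ max 1 T := le_max_left _ _
      have h4 : T ≤ max 1 T := le_max_right _ _
      refine h1.trans (max_le ?_ ?_)
      · nlinarith
      · nlinarith
    have hτd : (τ : ℝ) ^ d ≤ M * max 1 (T ^ d) := by
      have h1 : (max 1 T) ^ d = max 1 (T ^ d) := by
        have hm : MonotoneOn (fun x : ℝ => x ^ d) (Set.Ici 0) :=
          fun x hx y _ hxy => pow_le_pow_left₀ hx hxy d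
        have := hm.map_max (a := 1) (b := T) (Set.mem_Ici.mpr zero_le_one) hTpos.le
        simpa using this
      rw [← h1, hM, ← mul_pow]
      gcongr
    refine ⟨τ, le_min (by omega) (hK2.trans (le_max_left _ _)), hτN, ?_, fun θ hθ => ?_⟩
    · rw [cutoff_pow_eq hkd hd hN0 hCn]
      push_cast
      refine hτd.trans ?_
      gcongr
      linarith
    · refine (smooth_risk_le hkd hN σ Cn hCn hH hmono σp hσp v hv hev θ hθ τ hτN
        fun hlt => ?_).trans (ENNReal.ofReal_le_ofReal ?_)
      · have hτ' : τ = max K ⌈T⌉₊ := by omega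
        rw [hτ']
        refine ⟨le_max_left _ _, (Nat.le_ceil T).trans ?_⟩
        exact_mod_cast le_max_right _ _
      · rw [← cutoff_pow_div hkd hd hN0 hCn, ← add_div, mul_div_assoc']
        gcongr
        have hs := smoothConst_pos hkd
        have hTd : 0 ≤ T ^ d := by positivity
        have h1 : max 1 (T ^ d) ≤ 1 + T ^ d := max_le (by linarith) (by linarith)
        have h2 : σ ^ 2 * (τ : ℝ) ^ d ≤ σ ^ 2 * (M * (1 + T ^ d)) := by
          gcongr
          exact hτd.trans (by gcongr)
        have h3 : σ ^ 2 * (M * (1 + T ^ d)) + smoothConst k d * T ^ d ≤ B * (1 + T ^ d) := by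
          rw [hB, if_pos hkd]
          linarith
        refine (add_le_add h2 le_rfl).trans (h3.trans ?_)
        gcongr
        linarith
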